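/- arXiv:2311.17706 — 7 statements merged into one kernel-verified Lean document; each statement's English description precedes it below -/
import Mathlib

section
/- Let p be an odd prime, n ≥ 1, m ≥ 1, and let f = f₁/f₂ be a non-constant rational function in n variables with f₁, f₂ ∈ ℤ[x₁,...,xₙ] whose reductions modulo p are coprime. Set r := min_{1≤i≤n} ord_p(∂f/∂xᵢ) and suppose m − r is odd and positive. Then for every α ∈ ℤ^n, S_α(f, p^m) = p^{(m+r−1)n/2} · Σ e_{p^m}(f(y)), where the sum runs over y ∈ (ℤ_p/p^{(m−r+1)/2}ℤ_p)^n with y ≡ α (mod p), f₂(y) ≢ 0 (mod p), and p^{−r}∇f(y) ≡ 0 (mod p^{(m−r−1)/2}). -/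
open MvPolynomial

/-- The additive character `e_q(a) = e^{2πia/q}`, defined on residues modulo `q`. -/
noncomputable def eChar (q : ℕ) (a : ZMod q) : ℂ :=
  Complex.exp (2 * Real.pi * Complex.I * (a.val : ℂ) / (q : ℂ))

/-- `ord_p(g)`: the largest `k` such that `p^k` divides all coefficients of `g`. -/
noncomputable def polyOrd (p : ℕ) {n : ℕ} (g : MvPolynomial (Fin n) ℤ) : ℕ :=
  sSup {k : ℕ | ∀ d, (p : ℤ) ^ k ∣ g.coeff d}

/-- The numerator of the `i`-th partial derivative of the rational function `f₁/f₂`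
(whose denominator is `f₂^2`). -/
noncomputable def gradNum {n : ℕ} (f₁ f₂ : MvPolynomial (Fin n) ℤ) (i : Fin n) :
    MvPolynomial (Fin n) ℤ :=
  f₂ * pderiv i f₁ - f₁ * pderiv i f₂

/-- The value of `f₁/f₂` at an integer point, as an element of `ZMod q`
(using the multiplicative inverse of `f₂(x)` modulo `q`). -/
noncomputable def ratVal {n : ℕ} (f₁ f₂ : MvPolynomial (Fin n) ℤ) (q : ℕ)
    (x : Fin n → ℤ) : ZMod q :=
  ((eval x f₁ : ℤ) : ZMod q) * ((eval x f₂ : ℤ) : ZMod q)⁻¹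

theorem eChar_eq_stdAddChar (q : ℕ) [NeZero q] (a : ZMod q) :
    eChar q a = ZMod.stdAddChar a := by
  rw [ZMod.stdAddChar_apply, ZMod.toCircle_apply, eChar]

/-- The character modulo `a * b` at a multiple of `a` is the character modulo `b`. -/
theorem stdAddChar_intCast_mul (a b c : ℕ) [NeZero a] [NeZero b] [NeZero c] (hc : c = a * b)
    (k : ℤ) :
    ZMod.stdAddChar (((a : ℤ) * k : ℤ) : ZMod c) = ZMod.stdAddChar (k : ZMod b) := by
  rw [ZMod.stdAddChar_coe, ZMod.stdAddChar_coe]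
  congr 1
  have ha : (a : ℂ) ≠ 0 := by exact_mod_cast NeZero.ne a
  have hb : (b : ℂ) ≠ 0 := by exact_mod_cast NeZero.ne b
  subst hc
  push_cast
  field_simp

theorem stdAddChar_sum {ι : Type*} (b : ℕ) [NeZero b] (t : Finset ι) (g : ι → ZMod b) :
    ZMod.stdAddChar (∑ i ∈ t, g i) = ∏ i ∈ t, ZMod.stdAddChar (g i) := by
  classical
  induction t using Finset.induction_on with
  | empty => simp
  | insert i t hi ih => rw [Finset.sum_insert hi, Finset.prod_insert hi,
      AddChar.map_add_eq_mul, ih]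

/-- Orthogonality of additive characters in several variables. -/
theorem sum_stdAddChar_linear (b n : ℕ) [NeZero b] (g : Fin n → ℤ) :
    ∑ z : Fin n → ZMod b, ZMod.stdAddChar ((∑ i, g i * ((z i).val : ℤ) : ℤ) : ZMod b) =
      if ∀ i, (b : ℤ) ∣ g i then (b : ℂ) ^ n else 0 := by
  have one_var (i : Fin n) : ∑ x : ZMod b, ZMod.stdAddChar (x * (g i : ZMod b)) =
      if (b : ℤ) ∣ g i then (b : ℂ) else 0 := by
    rw [AddChar.sum_mulShift _ (ZMod.isPrimitive_stdAddChar b)]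
    simp [ZMod.intCast_zmod_eq_zero_iff_dvd]
  calc
    _ = ∑ z : Fin n → ZMod b, ∏ i, ZMod.stdAddChar (z i * (g i : ZMod b)) := by
      refine Finset.sum_congr rfl fun z _ => ?_
      rw [← stdAddChar_sum]
      congr 1
      push_cast
      exact Finset.sum_congr rfl fun i _ => by simp [mul_comm]
    _ = ∏ i, ∑ x : ZMod b, ZMod.stdAddChar (x * (g i : ZMod b)) :=
      (Fintype.prod_sum fun i (x : ZMod b) => ZMod.stdAddChar (x * (g i : ZMod b))).symm
    _ = _ := by
      simp_rw [one_var]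
      rw [Fintype.prod_ite_zero]
      simp

/-- Writing residues modulo `a * b` as `y + a * z` with digits `y` and `z`. -/
theorem sum_zmod_digits {M : Type*} [AddCommMonoid M] (a b c n : ℕ) [NeZero a] [NeZero b]
    [NeZero c] (hc : c = a * b) (G : (Fin n → ℤ) → M) :
    ∑ x : Fin n → ZMod c, G (fun i => ((x i).val : ℤ)) =
      ∑ y : Fin n → ZMod a, ∑ z : Fin n → ZMod b,
        G (fun i => ((y i).val : ℤ) + (a : ℤ) * ((z i).val : ℤ)) := by
  let φ : ZMod a × ZMod b → ZMod c := fun w => ((w.1.val + a * w.2.val : ℕ) : ZMod c)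
  have hval (w : ZMod a × ZMod b) : (φ w).val = w.1.val + a * w.2.val := by
    refine ZMod.val_natCast_of_lt ?_
    have h₁ := ZMod.val_lt w.1
    have h₂ := ZMod.val_lt w.2
    subst hc
    nlinarith
  have hinj : Function.Injective φ := by
    intro w w' h
    have hv : w.1.val + a * w.2.val = w'.1.val + a * w'.2.val := by
      rw [← hval, ← hval, h]
    have h₁ := ZMod.val_lt w.1
    have h₂ := ZMod.val_lt w'.1
    have hmod := congrArg (· % a) hv
    simp only [Nat.add_mul_mod_self_left, Nat.mod_eq_of_lt h₁, Nat.mod_eq_of_lt h₂] at hmod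
    rw [hmod, Nat.add_left_cancel_iff] at hv
    exact Prod.ext (ZMod.val_injective a hmod)
      (ZMod.val_injective b (Nat.eq_of_mul_eq_mul_left (NeZero.pos a) hv))
  have hbij : Function.Bijective φ :=
    (Fintype.bijective_iff_injective_and_card φ).mpr ⟨hinj, by simp [ZMod.card, hc]⟩
  let e : (Fin n → ZMod a) × (Fin n → ZMod b) ≃ (Fin n → ZMod c) :=
    (Equiv.arrowProdEquivProdArrow (Fin n) (fun _ => ZMod a) (fun _ => ZMod b)).symm.trans
      (Equiv.arrowCongr (Equiv.refl _) (Equiv.ofBijective φ hbij))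
  rw [← Equiv.sum_comp e, Fintype.sum_prod_type]
  refine Finset.sum_congr rfl fun y _ => Finset.sum_congr rfl fun z _ => ?_
  congr 1
  funext i
  have h : e (y, z) i = φ (y i, z i) := rfl
  rw [h, hval]
  push_cast
  rfl

theorem pow_dvd_coeff_of_le_polyOrd {p n r : ℕ} {g : MvPolynomial (Fin n) ℤ}
    (h : r ≤ polyOrd p g) (d : Fin n →₀ ℕ) : (p : ℤ) ^ r ∣ g.coeff d := by
  rcases Nat.eq_zero_or_pos r with rfl | hr
  · simp
  have hne : {k : ℕ | ∀ d, (p : ℤ) ^ k ∣ g.coeff d}.Nonempty := ⟨0, by simp⟩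
  have hbdd : BddAbove {k : ℕ | ∀ d, (p : ℤ) ^ k ∣ g.coeff d} := by
    by_contra hb
    have := Nat.sSup_of_not_bddAbove hb
    rw [polyOrd] at h
    omega
  exact (pow_dvd_pow _ h).trans (Nat.sSup_mem hne hbdd d)

/-- The chain rule for substituting univariate polynomials into a multivariate one. -/
theorem derivative_aeval {R σ : Type*} [CommRing R] [Fintype σ] [DecidableEq σ]
    (g : σ → Polynomial R) (F : MvPolynomial σ R) :
    Polynomial.derivative (aeval g F) =
      ∑ i, aeval g (pderiv i F) * Polynomial.derivative (g i) := by
  induction F using MvPolynomial.induction_on with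
  | C a => simp
  | add F G hF hG => simp [hF, hG, add_mul, Finset.sum_add_distrib]
  | mul_X F j hF =>
    have hterm (i : σ) : aeval g (pderiv i (F * X j)) * Polynomial.derivative (g i) =
        aeval g (pderiv i F) * Polynomial.derivative (g i) * g j +
          if i = j then aeval g F * Polynomial.derivative (g j) else 0 := by
      rw [pderiv_mul, pderiv_X, map_add, map_mul, map_mul, aeval_X]
      rcases eq_or_ne i j with rfl | hij
      · simp only [Pi.single_eq_same, map_one, if_true]
        ring
      · simp only [Pi.single_eq_of_ne' hij, map_zero, if_neg hij]
        ring
    simp_rw [hterm]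
    rw [map_mul, aeval_X, Polynomial.derivative_mul, hF, Finset.sum_add_distrib, Finset.sum_mul,
      Finset.sum_ite_eq' Finset.univ j, if_pos (Finset.mem_univ j)]

/-- First-order Taylor expansion of a polynomial whose derivative is divisible by `p ^ r`. -/
theorem eval_pow_modEq {p : ℕ} (hp : p.Prime) (r s : ℕ) (P : Polynomial ℤ)
    (hP : Polynomial.C ((p : ℤ) ^ r) ∣ Polynomial.derivative P) :
    P.eval ((p : ℤ) ^ (s + 1)) ≡ P.coeff 0 + (p : ℤ) ^ (s + 1) * P.coeff 1
      [ZMOD (p : ℤ) ^ (r + 2 * s + 1)] := by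
  have higher (k : ℕ) : (p : ℤ) ^ (r + 2 * s + 1) ∣
      P.coeff (k + 2) * ((p : ℤ) ^ (s + 1)) ^ (k + 2) := by
    have h₁ : (p : ℤ) ^ r ∣ P.coeff (k + 2) * ((k + 2 : ℕ) : ℤ) := by
      have := (Polynomial.C_dvd_iff_dvd_coeff _ _).mp hP (k + 1)
      rw [Polynomial.coeff_derivative] at this
      push_cast at this ⊢
      rwa [add_assoc, one_add_one_eq_two] at this
    obtain ⟨v, u, hu, hk⟩ := Nat.exists_eq_pow_mul_and_not_dvd (n := k + 2) (by omega) p hp.ne_one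
    have hcop : IsCoprime ((p : ℤ) ^ r) (u : ℤ) :=
      (Nat.isCoprime_iff_coprime.mpr ((hp.coprime_iff_not_dvd).mpr hu)).pow_left
    have h₂ : (p : ℤ) ^ r ∣ P.coeff (k + 2) * (p : ℤ) ^ v := by
      refine hcop.dvd_of_dvd_mul_right ?_
      rw [hk] at h₁
      push_cast at h₁
      rwa [← mul_assoc, ← hk] at h₁
    have hv : v < k + 2 := by
      have hlt := Nat.lt_pow_self hp.one_lt (n := v)
      have hle : p ^ v ≤ k + 2 := Nat.le_of_dvd (by omega) ⟨u, hk⟩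
      omega
    calc (p : ℤ) ^ (r + 2 * s + 1) = (p : ℤ) ^ r * (p : ℤ) ^ (2 * s + 1) := by ring
      _ ∣ P.coeff (k + 2) * (p : ℤ) ^ v * (p : ℤ) ^ (2 * s + 1) := mul_dvd_mul_right h₂ _
      _ = P.coeff (k + 2) * (p : ℤ) ^ (v + (2 * s + 1)) := by ring
      _ ∣ _ := by
        rw [← pow_mul]
        exact mul_dvd_mul_left _ (pow_dvd_pow _ (by nlinarith))
  have hdeg : P.natDegree < P.natDegree + 2 := by omega
  rw [Polynomial.eval_eq_sum_range' hdeg, Finset.sum_range_succ', Finset.sum_range_succ']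
  refine (Int.modEq_iff_dvd.mpr ?_).symm
  have hsub (A c₀ c₁ q : ℤ) : A + c₁ * q ^ (0 + 1) + c₀ * q ^ 0 - (c₀ + q * c₁) = A := by ring
  rw [hsub]
  exact Finset.dvd_sum fun k _ => higher k

/-- First-order Taylor expansion of a multivariate polynomial whose gradient is divisible
by `p ^ r`. -/
theorem eval_add_pow_mul_modEq {p : ℕ} (hp : p.Prime) (r s n : ℕ) (F : MvPolynomial (Fin n) ℤ)
    (hF : ∀ i, C ((p : ℤ) ^ r) ∣ pderiv i F) (y z : Fin n → ℤ) :
    eval (fun i => y i + (p : ℤ) ^ (s + 1) * z i) F ≡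
      eval y F + (p : ℤ) ^ (s + 1) * ∑ i, eval y (pderiv i F) * z i
      [ZMOD (p : ℤ) ^ (r + 2 * s + 1)] := by
  let g : Fin n → Polynomial ℤ := fun i => Polynomial.C (y i) + Polynomial.C (z i) * Polynomial.X
  have hg (i : Fin n) : Polynomial.derivative (g i) = Polynomial.C (z i) := by simp [g]
  have heval (t : ℤ) (G : MvPolynomial (Fin n) ℤ) :
      (aeval g G).eval t = eval (fun i => y i + t * z i) G := by
    induction G using MvPolynomial.induction_on with
    | C a => simp
    | add G H hG hH => simp [hG, hH]
    | mul_X G j hG =>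
      rw [map_mul, Polynomial.eval_mul, hG, map_mul, aeval_X, eval_X]
      simp [g, mul_comm t]
  have hdvd : Polynomial.C ((p : ℤ) ^ r) ∣ Polynomial.derivative (aeval g F) := by
    rw [derivative_aeval]
    refine Finset.dvd_sum fun i _ => Dvd.dvd.mul_right ?_ _
    have := map_dvd (aeval g) (hF i)
    simpa using this
  have h₀ : (aeval g F).coeff 0 = eval y F := by
    rw [Polynomial.coeff_zero_eq_eval_zero, heval]
    simp
  have h₁ : (aeval g F).coeff 1 = ∑ i, eval y (pderiv i F) * z i := by
    have h := Polynomial.coeff_derivative (aeval g F) 0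
    rw [Polynomial.coeff_zero_eq_eval_zero, derivative_aeval, Polynomial.eval_finsetSum] at h
    simp only [Polynomial.eval_mul, heval, hg, Polynomial.eval_C] at h
    simpa using h.symm
  have := eval_pow_modEq hp r s (aeval g F) hdvd
  rwa [heval, h₀, h₁] at this

theorem dvd_eval_sub_eval {n : ℕ} (a : ℤ) (F : MvPolynomial (Fin n) ℤ) (y z : Fin n → ℤ) :
    a ∣ eval (fun i => y i + a * z i) F - eval y F := by
  induction F using MvPolynomial.induction_on with
  | C c => simp
  | add F G hF hG =>
    rw [map_add, map_add, add_sub_add_comm]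
    exact dvd_add hF hG
  | mul_X F j hF =>
    have hsub (A B c d : ℤ) : A * (c + a * d) - B * c = (A - B) * (c + a * d) + a * (d * B) := by
      ring
    rw [map_mul, map_mul, eval_X, eval_X, hsub]
    exact dvd_add (hF.mul_right _) (dvd_mul_right a _)

/-- The gradient of `f₁ * f₂ ^ (k + 1)`, which agrees with `f₁ / f₂` modulo `p ^ m` when
`k + 2` is a multiple of the totient of `p ^ m`. -/
theorem pderiv_mul_pow {n : ℕ} (f₁ f₂ : MvPolynomial (Fin n) ℤ) (k : ℕ) (i : Fin n) :
    pderiv i (f₁ * f₂ ^ (k + 1)) =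
      f₂ ^ k * gradNum f₁ f₂ i + C ((k + 2 : ℕ) : ℤ) * (f₁ * f₂ ^ k * pderiv i f₂) := by
  rw [gradNum, pderiv_mul, pderiv_pow]
  simp only [Nat.add_sub_cancel, map_natCast]
  push_cast
  ring

theorem ratVal_eq_intCast {n : ℕ} (f₁ f₂ : MvPolynomial (Fin n) ℤ) {p m k : ℕ} (hp : p.Prime)
    (hk : Nat.totient (p ^ m) ∣ k + 2) (x : Fin n → ℤ) (hx : ¬ (p : ℤ) ∣ eval x f₂) :
    ratVal f₁ f₂ (p ^ m) x = ((eval x (f₁ * f₂ ^ (k + 1)) : ℤ) : ZMod (p ^ m)) := by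
  have hcop : IsCoprime ((p ^ m : ℕ) : ℤ) (eval x f₂) := by
    push_cast
    exact ((Nat.prime_iff_prime_int.mp hp).coprime_iff_not_dvd.mpr hx).pow_left
  obtain ⟨u, hu⟩ := (ZMod.coe_int_isUnit_iff_isCoprime (eval x f₂) (p ^ m)).mpr hcop
  obtain ⟨c, hc⟩ := hk
  have hone : u ^ (k + 1) * u = 1 := by
    rw [← pow_succ, hc, pow_mul, ZMod.pow_totient, one_pow]
  rw [ratVal, map_mul, map_pow]
  push_cast
  rw [← hu, ← Units.val_pow_eq_pow_val, eq_inv_of_mul_eq_one_left hone, ZMod.inv_coe_unit]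

/-- Proposition 1, case `m - r` odd: for an odd prime `p` and a non-constant rational
function `f = f₁/f₂` in `n` variables whose numerator and denominator are coprime mod `p`,
with `r = min_i ord_p(∂f/∂xᵢ)` and `m - r = 2s + 1 > 0`, the sum `S_α(f, p^m)` equals
`p^{(m+r-1)n/2}` times the sum of `e_{p^m}(f(y))` over `y mod p^{(m-r+1)/2}` with
`y ≡ α mod p`, `f₂(y) ≢ 0 mod p` and `p^{-r}∇f(y) ≡ 0 mod p^{(m-r-1)/2}`. -/
theorem stmt1 (p : ℕ) [NeZero p] (hp : p.Prime) (hodd : p ≠ 2)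
    (n : ℕ) (hn : 1 ≤ n) (f₁ f₂ : MvPolynomial (Fin n) ℤ)
    (hcop : IsRelPrime (f₁.map (Int.castRingHom (ZMod p))) (f₂.map (Int.castRingHom (ZMod p))))
    (hnc : ¬ ∃ a b : ℤ, b ≠ 0 ∧ (C b) * f₁ = (C a) * f₂)
    (m r s : ℕ) (hm : 1 ≤ m)
    (hrle : ∀ i, r ≤ polyOrd p (gradNum f₁ f₂ i))
    (hrex : ∃ i, polyOrd p (gradNum f₁ f₂ i) = r)
    (hms : m = r + 2 * s + 1)
    (α : Fin n → ℤ) :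
    (∑ x : Fin n → ZMod (p ^ m),
        if (∀ i, ((x i).val : ℤ) ≡ α i [ZMOD (p : ℤ)]) ∧
            ¬ (p : ℤ) ∣ eval (fun i => ((x i).val : ℤ)) f₂ then
          eChar (p ^ m) (ratVal f₁ f₂ (p ^ m) (fun i => ((x i).val : ℤ)))
        else 0)
      = (p : ℂ) ^ (n * (r + s)) *
        ∑ y : Fin n → ZMod (p ^ (s + 1)),
          if (∀ i, ((y i).val : ℤ) ≡ α i [ZMOD (p : ℤ)]) ∧
              (¬ (p : ℤ) ∣ eval (fun i => ((y i).val : ℤ)) f₂) ∧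
              (∀ i, (p : ℤ) ^ (r + s) ∣ eval (fun i => ((y i).val : ℤ)) (gradNum f₁ f₂ i)) then
            eChar (p ^ m) (ratVal f₁ f₂ (p ^ m) (fun i => ((y i).val : ℤ)))
          else 0 := by
  have hpz : Prime (p : ℤ) := Nat.prime_iff_prime_int.mp hp
  have hc : p ^ m = p ^ (s + 1) * p ^ (r + s) := by
    rw [hms, ← pow_add]
    congr 1
    omega
  obtain ⟨k, hk⟩ : ∃ k, Nat.totient (p ^ (m + 1)) = k + 2 := by
    refine Nat.exists_eq_add_of_le' ?_
    rw [Nat.totient_prime_pow_succ hp]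
    have h₁ := hp.two_le
    have h₂ : 1 ≤ p ^ m := Nat.one_le_pow _ _ hp.pos
    have h₃ : 2 ≤ p - 1 := by omega
    nlinarith
  have htot : Nat.totient (p ^ m) ∣ k + 2 :=
    hk ▸ Nat.totient_dvd_of_dvd (pow_dvd_pow p m.le_succ)
  have hpk : (p : ℤ) ^ m ∣ ((k + 2 : ℕ) : ℤ) := by
    rw [← hk, Nat.totient_prime_pow_succ hp]
    push_cast
    exact dvd_mul_right _ _
  set F := f₁ * f₂ ^ (k + 1) with hFdef
  have hF (i : Fin n) : C ((p : ℤ) ^ r) ∣ pderiv i F := by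
    rw [hFdef, pderiv_mul_pow]
    refine dvd_add (Dvd.dvd.mul_left ?_ _) (Dvd.dvd.mul_right (map_dvd C ?_) _)
    · exact (C_dvd_iff_dvd_coeff _ _).mpr (pow_dvd_coeff_of_le_polyOrd (hrle i))
    · exact (pow_dvd_pow _ (by omega)).trans hpk
  have hgrad (y : Fin n → ℤ) (hy : ¬ (p : ℤ) ∣ eval y f₂) (i : Fin n) :
      (p : ℤ) ^ (r + s) ∣ eval y (pderiv i F) ↔ (p : ℤ) ^ (r + s) ∣ eval y (gradNum f₁ f₂ i) := by
    have hcoprime : IsCoprime ((p : ℤ) ^ (r + s)) (eval y f₂ ^ k) :=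
      (hpz.coprime_iff_not_dvd.mpr hy).pow
    rw [hFdef, pderiv_mul_pow, map_add, map_mul, map_mul, eval_C, map_pow,
      dvd_add_left (((pow_dvd_pow _ (by omega)).trans hpk).mul_right _)]
    exact ⟨hcoprime.dvd_of_dvd_mul_left, fun h => h.mul_left _⟩
  rw [sum_zmod_digits (p ^ (s + 1)) (p ^ (r + s)) (p ^ m) n hc
    (fun x => if (∀ i, x i ≡ α i [ZMOD (p : ℤ)]) ∧ ¬ (p : ℤ) ∣ eval x f₂ then
      eChar (p ^ m) (ratVal f₁ f₂ (p ^ m) x) else 0), Finset.mul_sum]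
  refine Finset.sum_congr rfl fun w _ => ?_
  obtain ⟨y, hy⟩ : ∃ y : Fin n → ℤ, y = fun i => ((w i).val : ℤ) := ⟨_, rfl⟩
  have hyi (i : Fin n) : ((w i).val : ℤ) = y i := by rw [hy]
  simp only [hyi]
  have hps : (p : ℤ) ∣ (p : ℤ) ^ (s + 1) := dvd_pow_self _ s.succ_ne_zero
  have hmodα (z : Fin n → ZMod (p ^ (r + s))) (i : Fin n) :
      y i + ((p ^ (s + 1) : ℕ) : ℤ) * ((z i).val : ℤ) ≡ α i [ZMOD (p : ℤ)] ↔
        y i ≡ α i [ZMOD (p : ℤ)] := by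
    have h : y i + ((p ^ (s + 1) : ℕ) : ℤ) * ((z i).val : ℤ) ≡ y i [ZMOD (p : ℤ)] := by
      refine (Int.modEq_iff_dvd.mpr ?_).symm
      push_cast
      rw [add_sub_cancel_left]
      exact hps.mul_right _
    exact ⟨h.symm.trans, h.trans⟩
  have hmodf (z : Fin n → ZMod (p ^ (r + s))) :
      (p : ℤ) ∣ eval (fun i => y i + ((p ^ (s + 1) : ℕ) : ℤ) * ((z i).val : ℤ)) f₂ ↔
        (p : ℤ) ∣ eval y f₂ := by
    push_cast
    exact (dvd_iff_dvd_of_dvd_sub (hps.trans (dvd_eval_sub_eval _ f₂ y _)))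
  simp only [hmodα, hmodf]
  by_cases hα : ∀ i, y i ≡ α i [ZMOD (p : ℤ)]
  swap
  · simp [hα]
  by_cases hf : (p : ℤ) ∣ eval y f₂
  · simp [hf]
  simp only [hα, hf, not_false_eq_true, implies_true, true_and, if_true]
  have hterm (z : Fin n → ZMod (p ^ (r + s))) :
      eChar (p ^ m) (ratVal f₁ f₂ (p ^ m)
          (fun i => y i + ((p ^ (s + 1) : ℕ) : ℤ) * ((z i).val : ℤ))) =
        eChar (p ^ m) (ratVal f₁ f₂ (p ^ m) y) *
          ZMod.stdAddChar ((∑ i, eval y (pderiv i F) * ((z i).val : ℤ) : ℤ) :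
            ZMod (p ^ (r + s))) := by
    rw [ratVal_eq_intCast f₁ f₂ hp htot _ (fun h => hf ((hmodf z).mp h)),
      ratVal_eq_intCast f₁ f₂ hp htot y hf, eChar_eq_stdAddChar, eChar_eq_stdAddChar,
      ← stdAddChar_intCast_mul (p ^ (s + 1)) (p ^ (r + s)) (p ^ m) hc,
      ← AddChar.map_add_eq_mul, ← Int.cast_add]
    congr 1
    rw [ZMod.intCast_eq_intCast_iff]
    have := eval_add_pow_mul_modEq hp r s n F hF y (fun i => ((z i).val : ℤ))
    push_cast
    rwa [hms]
  simp only [hterm]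
  rw [← Finset.mul_sum, sum_stdAddChar_linear]
  have hiff : (∀ i, ((p ^ (r + s) : ℕ) : ℤ) ∣ eval y (pderiv i F)) ↔
      ∀ i, (p : ℤ) ^ (r + s) ∣ eval y (gradNum f₁ f₂ i) := by
    push_cast
    exact forall_congr' (hgrad y hf)
  simp only [hiff]
  split_ifs
  · push_cast
    ring
  · simp
end

section
/- Let p be an odd prime, n ≥ 1, and let f = f₁/f₂ be a non-constant rational function in n variables with f₁, f₂ ∈ ℤ[x₁,...,xₙ] whose reductions modulo p are coprime. Set r := min_{1≤i≤n} ord_p(∂f/∂xᵢ) and assume m − r ≥ 2. If α ∈ ℤ^n is not a critical point of f modulo p, i.e. p^{−r}∇f(α) ≢ 0 (mod p), then S_α(f, p^m) = 0. -/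
open MvPolynomial

theorem C_pow_dvd_of_le_polyOrd {p n r : ℕ} {g : MvPolynomial (Fin n) ℤ} (h : r ≤ polyOrd p g) :
    C ((p : ℤ) ^ r) ∣ g := by
  rw [C_dvd_iff_dvd_coeff]
  intro d
  by_cases hb : BddAbove {k : ℕ | ∀ d, (p : ℤ) ^ k ∣ g.coeff d}
  · have hmem := Nat.sSup_mem (s := {k : ℕ | ∀ d, (p : ℤ) ^ k ∣ g.coeff d}) ⟨0, by simp⟩ hb
    exact (pow_dvd_pow _ h).trans (hmem d)
  · have hzero : polyOrd p g = 0 := Nat.sSup_of_not_bddAbove hb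
    obtain rfl : r = 0 := by omega
    simp

theorem eval_modEq {σ : Type*} (f : MvPolynomial σ ℤ) {N : ℤ} {a b : σ → ℤ}
    (h : ∀ j, a j ≡ b j [ZMOD N]) : eval a f ≡ eval b f [ZMOD N] := by
  induction f using MvPolynomial.induction_on with
  | C c => simp
  | add f g hf hg => simpa using hf.add hg
  | mul_X f j hf => simpa using hf.mul (h j)

theorem ratVal_congr {n : ℕ} (f₁ f₂ : MvPolynomial (Fin n) ℤ) {q : ℕ} {x y : Fin n → ℤ}
    (h : ∀ j, x j ≡ y j [ZMOD q]) : ratVal f₁ f₂ q x = ratVal f₁ f₂ q y := by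
  rw [ratVal, ratVal, (ZMod.intCast_eq_intCast_iff _ _ _).2 (eval_modEq f₁ h),
    (ZMod.intCast_eq_intCast_iff _ _ _).2 (eval_modEq f₂ h)]

/-- The restriction of a polynomial to the line through `x` in the `i`-th coordinate direction. -/
noncomputable def lineRestrict {n : ℕ} (x : Fin n → ℤ) (i : Fin n) :
    MvPolynomial (Fin n) ℤ →ₐ[ℤ] Polynomial ℤ :=
  aeval fun j => Polynomial.C (x j) + (Pi.single i Polynomial.X : Fin n → Polynomial ℤ) j

theorem eval_lineRestrict {n : ℕ} (x : Fin n → ℤ) (i : Fin n) (f : MvPolynomial (Fin n) ℤ)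
    (h : ℤ) : (lineRestrict x i f).eval h = eval (x + Pi.single i h) f := by
  induction f using MvPolynomial.induction_on with
  | C c => simp [lineRestrict]
  | add f g hf hg => simp [hf, hg]
  | mul_X f j hf =>
    rw [map_mul, Polynomial.eval_mul, hf, map_mul]
    rcases eq_or_ne j i with rfl | hj
    · simp [lineRestrict]
    · simp [lineRestrict, hj]

theorem derivative_lineRestrict {n : ℕ} (x : Fin n → ℤ) (i : Fin n)
    (f : MvPolynomial (Fin n) ℤ) :
    Polynomial.derivative (lineRestrict x i f) = lineRestrict x i (pderiv i f) := by
  induction f using MvPolynomial.induction_on with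
  | C c => simp [lineRestrict]
  | add f g hf hg => simp [hf, hg]
  | mul_X f j hf =>
    rw [map_mul, Polynomial.derivative_mul, hf, Derivation.leibniz]
    rcases eq_or_ne j i with rfl | hj
    · simp [lineRestrict]; ring
    · simp [lineRestrict, hj]; ring

/-- If `F D' ≡ F' D` modulo `a`, then `F ^ k D^{(k)}` is a multiple of `D` modulo `a`. -/
theorem exists_pow_mul_iterate_derivative_eq {F D E a : Polynomial ℤ}
    (ha : Polynomial.derivative a = 0)
    (h : F * Polynomial.derivative D - Polynomial.derivative F * D = a * E) (k : ℕ) :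
    ∃ A B, F ^ k * Polynomial.derivative^[k] D = a * A + D * B := by
  induction k with
  | zero => exact ⟨0, 1, by simp⟩
  | succ k ih =>
    obtain ⟨A, B, hAB⟩ := ih
    have hder := congrArg Polynomial.derivative hAB
    simp only [Polynomial.derivative_mul, Polynomial.derivative_add, Polynomial.derivative_pow,
      ha] at hder
    rw [Function.iterate_succ_apply']
    refine ⟨Polynomial.derivative A * F + E * B - k * Polynomial.derivative F * A,
      Polynomial.derivative F * B + F * Polynomial.derivative B
        - k * Polynomial.derivative F * B, ?_⟩
    cases k with
    | zero =>
      simp only [Function.iterate_zero, id, pow_zero, Nat.cast_zero, Polynomial.C_0] at *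
      linear_combination F * hder + B * h
    | succ k =>
      simp only [Nat.add_sub_cancel, Polynomial.C_eq_natCast] at hder
      linear_combination F * hder + B * h - (k + 1 : ℕ) * Polynomial.derivative F * hAB

theorem padicValNat_factorial_le_sub_two {p : ℕ} (hp : p.Prime) (hodd : p ≠ 2) {k : ℕ}
    (hk : 2 ≤ k) : padicValNat p k.factorial ≤ k - 2 := by
  have := Fact.mk hp
  have hlt := sub_one_mul_padicValNat_factorial_lt_of_ne_zero p (n := k) (by omega)
  have hp3 : 2 ≤ p - 1 := by have := hp.two_le; omega
  have := Nat.mul_le_mul_right (padicValNat p k.factorial) hp3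
  omega

theorem pow_dvd_pow_sub_two_mul {p : ℕ} (hp : p.Prime) (hodd : p ≠ 2) {r k : ℕ} (hk : 2 ≤ k)
    {d : ℤ} (h : (p : ℤ) ^ r ∣ k.factorial * d) : (p : ℤ) ^ r ∣ (p : ℤ) ^ (k - 2) * d := by
  have := Fact.mk hp
  have hu : ¬ p ∣ k.factorial / p ^ padicValNat p k.factorial := by
    rw [← Nat.factorization_def _ hp]
    exact Nat.not_dvd_ordCompl hp k.factorial_ne_zero
  have hfac : (k.factorial : ℤ) = (p : ℤ) ^ padicValNat p k.factorial *
      ((k.factorial / p ^ padicValNat p k.factorial : ℕ) : ℤ) := by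
    exact_mod_cast (Nat.mul_div_cancel' (pow_padicValNat_dvd (p := p) (n := k.factorial))).symm
  have hcop : IsCoprime ((p : ℤ) ^ r)
      ((k.factorial / p ^ padicValNat p k.factorial : ℕ) : ℤ) :=
    (Nat.isCoprime_iff_coprime.2 ((Nat.Prime.coprime_iff_not_dvd hp).2 hu)).pow_left
  rw [hfac, mul_right_comm] at h
  exact (hcop.dvd_of_dvd_mul_right h).trans
    (mul_dvd_mul_right (pow_dvd_pow _ (padicValNat_factorial_le_sub_two hp hodd hk)) _)

/-- The first order Taylor expansion of `F₁ / F₂` at `0`, after clearing denominators. -/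
theorem pow_dvd_taylor_remainder {p : ℕ} (hp : p.Prime) (hodd : p ≠ 2) {r s : ℕ} (hs : 1 ≤ s)
    {F₁ F₂ : Polynomial ℤ} (h0 : ¬ (p : ℤ) ∣ F₂.eval 0)
    (hW : Polynomial.C ((p : ℤ) ^ r) ∣
      F₂ * Polynomial.derivative F₁ - F₁ * Polynomial.derivative F₂) :
    (p : ℤ) ^ (s + r + 1) ∣ F₂.eval 0 * F₁.eval ((p : ℤ) ^ s) - F₁.eval 0 * F₂.eval ((p : ℤ) ^ s)
      - (p : ℤ) ^ s *
        (F₂ * Polynomial.derivative F₁ - F₁ * Polynomial.derivative F₂).eval 0 := by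
  obtain ⟨E, hE⟩ := hW
  set D : Polynomial ℤ := Polynomial.C (F₂.eval 0) * F₁ - Polynomial.C (F₁.eval 0) * F₂ with hD
  have hD0 : D.eval 0 = 0 := by simp [hD]; ring
  have hD1 : D.coeff 1 =
      (F₂ * Polynomial.derivative F₁ - F₁ * Polynomial.derivative F₂).eval 0 := by
    have hcoeff : D.coeff 1 = (Polynomial.derivative D).eval 0 := by
      rw [← Polynomial.coeff_zero_eq_eval_zero, Polynomial.coeff_derivative]; simp
    rw [hcoeff]; simp [hD]
  have hDE : F₂ * Polynomial.derivative D - Polynomial.derivative F₂ * D =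
      Polynomial.C ((p : ℤ) ^ r) * (Polynomial.C (F₂.eval 0) * E) := by
    simp only [hD, Polynomial.derivative_sub, Polynomial.derivative_C_mul]
    linear_combination Polynomial.C (F₂.eval 0) * hE
  have hpp : Prime (p : ℤ) := Nat.prime_iff_prime_int.1 hp
  have hfac (k : ℕ) : (p : ℤ) ^ r ∣ k.factorial * D.coeff k := by
    obtain ⟨A, B, hAB⟩ := exists_pow_mul_iterate_derivative_eq Polynomial.derivative_C hDE k
    have hev := congrArg (Polynomial.eval 0) hAB
    have hkth : (Polynomial.derivative^[k] D).eval 0 = k.factorial * D.coeff k := by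
      rw [← Polynomial.coeff_zero_eq_eval_zero, Polynomial.coeff_iterate_derivative]
      simp [Nat.descFactorial_self]
    simp only [Polynomial.eval_mul, Polynomial.eval_add, Polynomial.eval_pow, Polynomial.eval_C,
      hD0, hkth, zero_mul, add_zero] at hev
    have hcop : IsCoprime ((p : ℤ) ^ r) (F₂.eval 0 ^ k) :=
      (((Prime.coprime_iff_not_dvd hpp).2 h0)).pow
    exact hcop.dvd_of_dvd_mul_left (hev ▸ dvd_mul_right _ _)
  have hterm (k : ℕ) (hk : 2 ≤ k) : (p : ℤ) ^ (s + r + 1) ∣ D.coeff k * ((p : ℤ) ^ s) ^ k := by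
    obtain ⟨c, hc⟩ := pow_dvd_pow_sub_two_mul hp hodd hk (hfac k)
    obtain ⟨j, rfl⟩ := Nat.exists_eq_add_of_le hk
    obtain ⟨t, rfl⟩ := Nat.exists_eq_add_of_le hs
    refine ⟨c * (p : ℤ) ^ (t * (j + 1)), ?_⟩
    rw [show 2 + j - 2 = j by omega] at hc
    calc D.coeff (2 + j) * ((p : ℤ) ^ (1 + t)) ^ (2 + j)
        = (p : ℤ) ^ j * D.coeff (2 + j) * (p : ℤ) ^ (2 + t + t * (j + 1)) := by ring
      _ = _ := by rw [hc]; ring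
  have hsum : D.eval ((p : ℤ) ^ s) - (p : ℤ) ^ s * D.coeff 1 =
      ∑ k ∈ Finset.range D.natDegree, D.coeff (k + 2) * ((p : ℤ) ^ s) ^ (k + 2) := by
    rw [Polynomial.eval_eq_sum_range' (show D.natDegree < D.natDegree + 1 + 1 by omega),
      Finset.sum_range_succ', Finset.sum_range_succ', Polynomial.coeff_zero_eq_eval_zero, hD0]
    ring
  rw [← hD1]
  have heval : D.eval ((p : ℤ) ^ s) =
      F₂.eval 0 * F₁.eval ((p : ℤ) ^ s) - F₁.eval 0 * F₂.eval ((p : ℤ) ^ s) := by simp [hD]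
  rw [← heval, hsum]
  exact Finset.dvd_sum fun k _ => hterm _ (by omega)

theorem isUnit_intCast_of_not_dvd {p : ℕ} (hp : p.Prime) (m : ℕ) {a : ℤ} (h : ¬ (p : ℤ) ∣ a) :
    IsUnit (a : ZMod (p ^ m)) := by
  rw [ZMod.coe_int_isUnit_iff_isCoprime]
  push_cast
  exact ((Prime.coprime_iff_not_dvd (Nat.prime_iff_prime_int.1 hp)).2 h).pow_left

/-- Translating one coordinate by `p ^ s` changes `f₁ / f₂` modulo `p ^ (s + r + 1)` by an amount
that depends only on the residue class of the point modulo `p`. -/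
theorem ratVal_add_single {p : ℕ} (hp : p.Prime) (hodd : p ≠ 2) {n r s : ℕ} (hs : 1 ≤ s)
    {f₁ f₂ : MvPolynomial (Fin n) ℤ} {i : Fin n} (hr : C ((p : ℤ) ^ r) ∣ gradNum f₁ f₂ i)
    {α x : Fin n → ℤ} (hx : ∀ j, x j ≡ α j [ZMOD p]) (hα : ¬ (p : ℤ) ∣ eval α f₂) :
    ratVal f₁ f₂ (p ^ (s + r + 1)) (x + Pi.single i ((p : ℤ) ^ s)) =
      ratVal f₁ f₂ (p ^ (s + r + 1)) x +
        (((p : ℤ) ^ s * eval α (gradNum f₁ f₂ i) : ℤ) : ZMod (p ^ (s + r + 1))) *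
          ((eval α f₂ : ℤ) : ZMod (p ^ (s + r + 1)))⁻¹ ^ 2 := by
  set y := x + Pi.single i ((p : ℤ) ^ s) with hy
  have hyx : ∀ j, y j ≡ x j [ZMOD p] := by
    intro j
    rw [Int.modEq_iff_dvd, hy]
    rcases eq_or_ne j i with rfl | hj
    · simpa using dvd_pow_self (p : ℤ) (by omega)
    · simp [hj]
  have hx2 : eval x f₂ ≡ eval α f₂ [ZMOD p] := eval_modEq f₂ hx
  have hy2 : eval y f₂ ≡ eval α f₂ [ZMOD p] := (eval_modEq f₂ hyx).trans hx2
  have hxn : ¬ (p : ℤ) ∣ eval x f₂ := by rwa [hx2.dvd_iff]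
  have hyn : ¬ (p : ℤ) ∣ eval y f₂ := by rwa [hy2.dvd_iff]
  have hdiff : lineRestrict x i f₂ * Polynomial.derivative (lineRestrict x i f₁) -
      lineRestrict x i f₁ * Polynomial.derivative (lineRestrict x i f₂) =
      lineRestrict x i (gradNum f₁ f₂ i) := by
    simp [derivative_lineRestrict, gradNum]
  have hW : Polynomial.C ((p : ℤ) ^ r) ∣ lineRestrict x i (gradNum f₁ f₂ i) := by
    have := map_dvd (lineRestrict x i) hr
    rwa [show lineRestrict x i (C ((p : ℤ) ^ r)) = Polynomial.C ((p : ℤ) ^ r) by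
      simp [lineRestrict]] at this
  have htaylor := pow_dvd_taylor_remainder hp hodd hs (r := r)
    (F₁ := lineRestrict x i f₁) (F₂ := lineRestrict x i f₂)
    (by simpa [eval_lineRestrict] using hxn) (by rwa [hdiff])
  rw [hdiff] at htaylor
  simp only [eval_lineRestrict, Pi.single_zero, add_zero, ← hy] at htaylor
  obtain ⟨G, hG⟩ := hr
  have hlin : (p : ℤ) ^ (s + r + 1) ∣
      (p : ℤ) ^ s * eval x (gradNum f₁ f₂ i) * eval α f₂ ^ 2 -
        (p : ℤ) ^ s * eval α (gradNum f₁ f₂ i) * (eval x f₂ * eval y f₂) := by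
    have hmod : eval α G * (eval x f₂ * eval y f₂) ≡ eval x G * eval α f₂ ^ 2 [ZMOD p] := by
      rw [sq]
      exact (eval_modEq G hx).symm.mul (hx2.mul hy2)
    obtain ⟨c, hc⟩ := hmod.dvd
    refine ⟨c, ?_⟩
    rw [hG]
    simp only [map_mul, eval_C]
    linear_combination (p : ℤ) ^ (s + r) * hc
  have e₁ := (ZMod.intCast_zmod_eq_zero_iff_dvd _ (p ^ (s + r + 1))).2 (by exact_mod_cast htaylor)
  have e₂ := (ZMod.intCast_zmod_eq_zero_iff_dvd _ (p ^ (s + r + 1))).2 (by exact_mod_cast hlin)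
  have ux := ZMod.mul_inv_of_unit _ (isUnit_intCast_of_not_dvd hp (s + r + 1) hxn)
  have uy := ZMod.mul_inv_of_unit _ (isUnit_intCast_of_not_dvd hp (s + r + 1) hyn)
  have uα := ZMod.mul_inv_of_unit _ (isUnit_intCast_of_not_dvd hp (s + r + 1) hα)
  have hunit := ((isUnit_intCast_of_not_dvd hp (s + r + 1) hxn).mul
    (isUnit_intCast_of_not_dvd hp (s + r + 1) hyn)).mul
    ((isUnit_intCast_of_not_dvd hp (s + r + 1) hα).pow 2)
  rw [ratVal, ratVal]
  push_cast at e₁ e₂ ⊢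
  apply hunit.mul_left_cancel
  generalize ((eval x f₂ : ℤ) : ZMod (p ^ (s + r + 1)))⁻¹ = ix at *
  generalize ((eval y f₂ : ℤ) : ZMod (p ^ (s + r + 1)))⁻¹ = iy at *
  generalize ((eval α f₂ : ℤ) : ZMod (p ^ (s + r + 1)))⁻¹ = ia at *
  generalize ((eval x f₂ : ℤ) : ZMod (p ^ (s + r + 1))) = bx at *
  generalize ((eval y f₂ : ℤ) : ZMod (p ^ (s + r + 1))) = b at *
  generalize ((eval α f₂ : ℤ) : ZMod (p ^ (s + r + 1))) = ba at *
  generalize ((eval x f₁ : ℤ) : ZMod (p ^ (s + r + 1))) = ax at *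
  generalize ((eval y f₁ : ℤ) : ZMod (p ^ (s + r + 1))) = a at *
  generalize ((eval x (gradNum f₁ f₂ i) : ℤ) : ZMod (p ^ (s + r + 1))) = gx at *
  generalize ((eval α (gradNum f₁ f₂ i) : ℤ) : ZMod (p ^ (s + r + 1))) = ga at *
  linear_combination ba ^ 2 * e₁ + e₂ + bx * ba ^ 2 * a * uy - b * ba ^ 2 * ax * ux -
    bx * b * (p : ZMod (p ^ (s + r + 1))) ^ s * ga * (ba * ia + 1) * uα

/-- Theorem 1 (i): for an odd prime `p`, a non-constant rational function `f = f₁/f₂`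
whose numerator and denominator are coprime mod `p`, `r = min_i ord_p(∂f/∂xᵢ)` and
`m - r ≥ 2`: if `α` is not a critical point of `f` mod `p`, i.e.
`p^{-r}∇f(α) ≢ 0 (mod p)`, then `S_α(f, p^m) = 0`. -/
theorem stmt2 (p : ℕ) [NeZero p] (hp : p.Prime) (hodd : p ≠ 2)
    (n : ℕ) (hn : 1 ≤ n) (f₁ f₂ : MvPolynomial (Fin n) ℤ)
    (hcop : IsRelPrime (f₁.map (Int.castRingHom (ZMod p))) (f₂.map (Int.castRingHom (ZMod p))))
    (hnc : ¬ ∃ a b : ℤ, b ≠ 0 ∧ (C b) * f₁ = (C a) * f₂)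
    (m r : ℕ)
    (hrle : ∀ i, r ≤ polyOrd p (gradNum f₁ f₂ i))
    (hrex : ∃ i, polyOrd p (gradNum f₁ f₂ i) = r)
    (hmr : r + 2 ≤ m)
    (α : Fin n → ℤ)
    (hnotcrit : ¬ ∀ i, (p : ℤ) ^ (r + 1) ∣ eval α (gradNum f₁ f₂ i)) :
    (∑ x : Fin n → ZMod (p ^ m),
        if (∀ i, ((x i).val : ℤ) ≡ α i [ZMOD (p : ℤ)]) ∧
            ¬ (p : ℤ) ∣ eval (fun i => ((x i).val : ℤ)) f₂ then
          eChar (p ^ m) (ratVal f₁ f₂ (p ^ m) (fun i => ((x i).val : ℤ)))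
        else 0) = 0 := by
  obtain ⟨s, hs, rfl⟩ : ∃ s, 1 ≤ s ∧ m = s + r + 1 := ⟨m - r - 1, by omega, by omega⟩
  by_cases hα : (p : ℤ) ∣ eval α f₂
  · refine Finset.sum_eq_zero fun x _ => if_neg ?_
    rintro ⟨hx, hxn⟩
    exact hxn ((eval_modEq f₂ hx).dvd_iff.2 hα)
  obtain ⟨i, hi⟩ := not_forall.1 hnotcrit
  set c : ZMod (p ^ (s + r + 1)) :=
    (((p : ℤ) ^ s * eval α (gradNum f₁ f₂ i) : ℤ) : ZMod (p ^ (s + r + 1))) *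
      ((eval α f₂ : ℤ) : ZMod (p ^ (s + r + 1)))⁻¹ ^ 2 with hc
  have hc0 : c ≠ 0 := by
    intro h0
    have uα := ZMod.mul_inv_of_unit _ (isUnit_intCast_of_not_dvd hp (s + r + 1) hα)
    have hinv := IsUnit.of_mul_eq_one_right _ uα
    rw [hc, (hinv.pow 2).mul_left_eq_zero, ZMod.intCast_zmod_eq_zero_iff_dvd] at h0
    push_cast at h0
    rw [add_assoc, pow_add] at h0
    exact hi (Int.dvd_of_mul_dvd_mul_left (pow_ne_zero _ (by exact_mod_cast hp.ne_zero)) h0)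
  set S : (Fin n → ZMod (p ^ (s + r + 1))) → ℂ := fun x =>
    if (∀ i, ((x i).val : ℤ) ≡ α i [ZMOD (p : ℤ)]) ∧
        ¬ (p : ℤ) ∣ eval (fun i => ((x i).val : ℤ)) f₂ then
      eChar (p ^ (s + r + 1)) (ratVal f₁ f₂ (p ^ (s + r + 1)) (fun i => ((x i).val : ℤ)))
    else 0 with hS
  set v : Fin n → ZMod (p ^ (s + r + 1)) := Pi.single i ((p : ZMod (p ^ (s + r + 1))) ^ s)
  have hstep (x : Fin n → ZMod (p ^ (s + r + 1))) : S (x + v) = ZMod.stdAddChar c * S x := by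
    set X : Fin n → ℤ := fun j => ((x j).val : ℤ) with hX
    set Z : Fin n → ℤ := fun j => (((x + v) j).val : ℤ) with hZ
    have hZX : ∀ j, Z j ≡ (X + Pi.single i ((p : ℤ) ^ s) : Fin n → ℤ) j
        [ZMOD ((p ^ (s + r + 1) : ℕ) : ℤ)] := by
      intro j
      rw [← ZMod.intCast_eq_intCast_iff]
      rcases eq_or_ne j i with rfl | hj
      · simp [hZ, hX, v]
      · simp [hZ, hX, v, hj]
    have hZXp : ∀ j, Z j ≡ X j [ZMOD p] := by
      intro j
      refine ((hZX j).of_dvd (by push_cast; exact dvd_pow_self _ (by omega))).trans ?_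
      rw [Int.modEq_iff_dvd]
      rcases eq_or_ne j i with rfl | hj
      · simpa using dvd_pow_self (p : ℤ) (by omega)
      · simp [hj]
    have hcond : ((∀ j, Z j ≡ α j [ZMOD p]) ∧ ¬ (p : ℤ) ∣ eval Z f₂) ↔
        ((∀ j, X j ≡ α j [ZMOD p]) ∧ ¬ (p : ℤ) ∣ eval X f₂) := by
      rw [(eval_modEq f₂ hZXp).dvd_iff]
      exact and_congr_left' (forall_congr' fun j =>
        ⟨fun h => (hZXp j).symm.trans h, fun h => (hZXp j).trans h⟩)
    by_cases hx : (∀ j, X j ≡ α j [ZMOD p]) ∧ ¬ (p : ℤ) ∣ eval X f₂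
    · simp only [hS]
      rw [if_pos (hcond.2 hx), if_pos hx, eChar_eq_stdAddChar, eChar_eq_stdAddChar,
        ratVal_congr f₁ f₂ hZX,
        ratVal_add_single hp hodd hs (C_pow_dvd_of_le_polyOrd (hrle i)) hx.1 hα,
        AddChar.map_add_eq_mul, mul_comm]
    · simp only [hS]
      rw [if_neg (mt hcond.1 hx), if_neg hx, mul_zero]
  have hsum : ∑ x, S x = ZMod.stdAddChar c * ∑ x, S x := by
    rw [Finset.mul_sum, ← Equiv.sum_comp (Equiv.addRight v) S]
    exact Finset.sum_congr rfl fun x _ => hstep x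
  have hne : (ZMod.stdAddChar c : ℂ) ≠ 1 := by
    rw [← AddChar.map_zero_eq_one (ZMod.stdAddChar (N := p ^ (s + r + 1)))]
    exact ZMod.injective_stdAddChar.ne hc0
  by_contra h0
  exact hne (mul_right_cancel₀ h0 (hsum.symm.trans (one_mul _).symm))
end

section
/- Let p be an odd prime, n ≥ 1, and let f = f₁/f₂ be a non-constant rational function in n variables with f₁, f₂ ∈ ℤ[x₁,...,xₙ] whose reductions modulo p are coprime. Set r := min_{1≤i≤n} ord_p(∂f/∂xᵢ), assume m − r ≥ 2 and that m − r is even. Suppose α ∈ ℤ^n satisfies p^{−r}∇f(α) ≡ 0 (mod p) and det(Hesse(f)(α)) ≢ 0 (mod p). Then S_α(f, p^m) = p^{n(m+r)/2} e_{p^m}(f(α*)), where α* is the unique lifting of α to a solution of p^{−r}∇f(x) ≡ 0 (mod p^m) with α* ≡ α (mod p). -/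
open MvPolynomial

/-- The numerator of the second partial derivative `∂²f/∂xⱼ∂xᵢ` of `f = f₁/f₂`
(whose denominator is `f₂^3`). -/
noncomputable def hesseNum {n : ℕ} (f₁ f₂ : MvPolynomial (Fin n) ℤ) (i j : Fin n) :
    MvPolynomial (Fin n) ℤ :=
  f₂ * pderiv j (gradNum f₁ f₂ i) - 2 * gradNum f₁ f₂ i * pderiv j f₂

/-- First-order Taylor expansion of a polynomial along `h`. -/
theorem exists_aeval_add_mul_eq {σ R : Type*} [Fintype σ] [CommRing R] (g : MvPolynomial σ ℤ)
    (x h : σ → R) (t : R) :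
    ∃ c, aeval (fun i => x i + t * h i) g =
      aeval x g + t * ∑ i, h i * aeval x (pderiv i g) + t ^ 2 * c := by
  classical
  induction g using MvPolynomial.induction_on with
  | C a => exact ⟨0, by simp⟩
  | add g₁ g₂ h₁ h₂ =>
    obtain ⟨c₁, h₁⟩ := h₁
    obtain ⟨c₂, h₂⟩ := h₂
    refine ⟨c₁ + c₂, ?_⟩
    simp only [map_add, h₁, h₂, mul_add, Finset.sum_add_distrib]
    ring
  | mul_X g j hg =>
    obtain ⟨c, hg⟩ := hg
    refine ⟨c * (x j + t * h j) + h j * ∑ i, h i * aeval x (pderiv i g), ?_⟩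
    have key : ∑ i, h i * aeval x (pderiv i (g * X j)) =
        h j * aeval x g + x j * ∑ i, h i * aeval x (pderiv i g) := by
      simp only [pderiv_mul, map_add, map_mul, aeval_X, pderiv_X, mul_add,
        Finset.sum_add_distrib, Finset.mul_sum]
      rw [add_comm]
      congr 1
      · rw [Finset.sum_eq_single j]
        · simp
        · intro i _ hij
          simp [Pi.single_eq_of_ne hij.symm]
        · simp
      · exact Finset.sum_congr rfl fun i _ => by ring
    rw [key, map_mul, map_mul, hg, aeval_X, aeval_X]
    ring

theorem exists_eq_add_mul {σ R : Type*} [CommRing R] {t : R} {x a : σ → R}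
    (hx : ∀ i, t ∣ x i - a i) : ∃ h : σ → R, x = fun i => a i + t * h i := by
  choose h hh using hx
  exact ⟨h, funext fun i => by rw [← hh i]; ring⟩

theorem dvd_aeval_sub_aeval {σ R : Type*} [Fintype σ] [CommRing R] (g : MvPolynomial σ ℤ)
    {t : R} {x a : σ → R} (hx : ∀ i, t ∣ x i - a i) : t ∣ aeval x g - aeval a g := by
  obtain ⟨h, rfl⟩ := exists_eq_add_mul hx
  obtain ⟨c, hc⟩ := exists_aeval_add_mul_eq g a h t
  rw [hc]
  exact ⟨∑ i, h i * aeval a (pderiv i g) + t * c, by ring⟩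

theorem isUnit_of_dvd_sub {R : Type*} [CommRing R] {t u v : R} (ht : IsNilpotent t)
    (hu : IsUnit u) (h : t ∣ v - u) : IsUnit v := by
  obtain ⟨c, hc⟩ := h
  obtain rfl : v = t * c + u := by rw [← hc]; ring
  exact ((Commute.all t c).isNilpotent_mul_right ht).isUnit_add_right_of_commute hu
    (Commute.all _ _)

/-- Uniqueness in the multivariable Hensel lemma. -/
theorem pow_dvd_sub_of_pow_dvd_aeval {σ R : Type*} [Fintype σ] [DecidableEq σ] [CommRing R]
    (N : σ → MvPolynomial σ ℤ) {t : R} {x a : σ → R} {s : ℕ}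
    (hJ : IsUnit (Matrix.of fun i j => aeval a (pderiv j (N i))).det)
    (ha : ∀ i, aeval a (N i) = 0) (hxa : ∀ i, t ∣ x i - a i)
    (hx : ∀ i, t ^ s ∣ aeval x (N i)) (i : σ) : t ^ s ∣ x i - a i := by
  have key : ∀ k, k + 1 ≤ s → ∀ i, t ^ (k + 1) ∣ x i - a i := by
    intro k
    induction k with
    | zero => simpa using fun _ => hxa
    | succ k ih =>
      intro hk
      obtain ⟨h, rfl⟩ := exists_eq_add_mul (ih (by omega))
      set J : Matrix σ σ R := Matrix.of fun i j => aeval a (pderiv j (N i)) with hJdef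
      have hJh : ∀ i, t ^ (k + 1 + 1) ∣ t ^ (k + 1) * (J.mulVec h) i := by
        intro i
        obtain ⟨c, hc⟩ := exists_aeval_add_mul_eq (N i) a h (t ^ (k + 1))
        have h1 : t ^ (k + 1) * (J.mulVec h) i =
            aeval (fun i => a i + t ^ (k + 1) * h i) (N i) - t ^ (k + 1 + 1) * (t ^ k * c) := by
          rw [hc, ha i]
          simp only [Matrix.mulVec, dotProduct, hJdef, Matrix.of_apply, mul_comm (h _)]
          ring
        rw [h1]
        exact dvd_sub ((pow_dvd_pow t hk).trans (hx i)) (dvd_mul_right _ _)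
      intro i
      have h2 : h = J⁻¹.mulVec (J.mulVec h) := by
        rw [Matrix.mulVec_mulVec, Matrix.nonsing_inv_mul _ hJ, Matrix.one_mulVec]
      have h3 : a i + t ^ (k + 1) * h i - a i =
          ∑ j, J⁻¹ i j * (t ^ (k + 1) * (J.mulVec h) j) := by
        conv_lhs => rw [h2]
        rw [Matrix.mulVec, dotProduct, Finset.mul_sum, add_sub_cancel_left]
        exact Finset.sum_congr rfl fun j _ => by ring
      rw [h3]
      exact Finset.dvd_sum fun j _ => (hJh j).mul_left _
  cases s with
  | zero => simp
  | succ k => exact key k le_rfl i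

theorem sum_stdAddChar_sum_mul {σ : Type*} [Fintype σ] [DecidableEq σ] (q : ℕ) [NeZero q]
    (b : σ → ZMod q) :
    ∑ h : σ → ZMod q, ZMod.stdAddChar (∑ i, h i * b i) =
      if ∀ i, b i = 0 then (q : ℂ) ^ Fintype.card σ else 0 := by
  have h1 : ∀ h : σ → ZMod q, ZMod.stdAddChar (∑ i, h i * b i) =
      ∏ i, ZMod.stdAddChar (h i * b i) := fun h => by
    simpa [← ofAdd_sum] using map_prod (ZMod.stdAddChar (N := q)).toMonoidHom
      (fun i => Multiplicative.ofAdd (h i * b i)) Finset.univ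
  simp only [h1]
  rw [← Fintype.prod_sum (fun i y => (ZMod.stdAddChar (y * b i) : ℂ))]
  simp only [AddChar.sum_mulShift _ (ZMod.isPrimitive_stdAddChar q), ZMod.card]
  split_ifs with hb
  · simp [hb]
  · push Not at hb
    obtain ⟨i, hi⟩ := hb
    exact Finset.prod_eq_zero (Finset.mem_univ i) (by simp [hi])

theorem card_filter_pow_dvd_sub {p s q : ℕ} [NeZero q] (hq : q = p ^ (2 * s)) (hp : p ≠ 0)
    (a : ZMod q) :
    (Finset.univ.filter fun y : ZMod q => (p : ZMod q) ^ s ∣ y - a).card = p ^ s := by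
  have h1 : (Finset.univ.filter fun y : ZMod q => (p : ZMod q) ^ s ∣ y - a).card =
      Nat.card (AddSubgroup.zmultiples ((p ^ s : ℕ) : ZMod q)) := by
    classical
    rw [Nat.card_eq_fintype_card, Fintype.card_subtype]
    refine Finset.card_equiv (Equiv.subRight a) fun y => ?_
    simp only [Finset.mem_filter_univ, Equiv.subRight_apply, AddSubgroup.mem_zmultiples_iff]
    constructor
    · rintro ⟨c, hc⟩
      exact ⟨c.val, by simp [hc, mul_comm]⟩
    · rintro ⟨k, hk⟩
      exact ⟨k, by rw [← hk]; simp [mul_comm]⟩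
  rw [h1, Nat.card_zmultiples, ZMod.addOrderOf_coe _ (NeZero.ne _), hq,
    Nat.gcd_eq_right (pow_dvd_pow p (by omega)), two_mul, pow_add,
    Nat.mul_div_cancel _ (by positivity)]

theorem ratio_aeval_add_mul {n q : ℕ} (f₁ f₂ : MvPolynomial (Fin n) ℤ) {x h : Fin n → ZMod q}
    {t : ZMod q} (ht : t ^ 2 = 0) (hx : IsUnit (aeval x f₂)) :
    aeval (fun i => x i + t * h i) f₁ * (aeval (fun i => x i + t * h i) f₂)⁻¹ =
      aeval x f₁ * (aeval x f₂)⁻¹ +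
        ∑ i, h i * (t * aeval x (gradNum f₁ f₂ i) * (aeval x f₂)⁻¹ ^ 2) := by
  obtain ⟨c₁, h₁⟩ := exists_aeval_add_mul_eq f₁ x h t
  obtain ⟨c₂, h₂⟩ := exists_aeval_add_mul_eq f₂ x h t
  have hu' : IsUnit (aeval (fun i => x i + t * h i) f₂) :=
    isUnit_of_dvd_sub ⟨2, ht⟩ hx (dvd_aeval_sub_aeval f₂ fun i => ⟨h i, by ring⟩)
  have hsum : ∑ i, h i * (t * aeval x (gradNum f₁ f₂ i) * (aeval x f₂)⁻¹ ^ 2) =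
      t * (aeval x f₂)⁻¹ ^ 2 * (aeval x f₂ * ∑ i, h i * aeval x (pderiv i f₁) -
        aeval x f₁ * ∑ i, h i * aeval x (pderiv i f₂)) := by
    simp only [Finset.mul_sum, ← Finset.sum_sub_distrib]
    refine Finset.sum_congr rfl fun i _ => ?_
    simp only [gradNum, map_sub, map_mul]
    ring
  have hx1 := ZMod.mul_inv_of_unit _ hx
  have hx2 := ZMod.mul_inv_of_unit _ hu'
  rw [hsum]
  refine hu'.mul_right_cancel ?_
  rw [mul_assoc, mul_comm _⁻¹, hx2, h₁, h₂, ht]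
  generalize aeval x f₁ = A, (aeval x f₂)⁻¹ = v at *
  generalize aeval x f₂ = u at *
  generalize ∑ i, h i * aeval x (pderiv i f₁) = b₁, ∑ i, h i * aeval x (pderiv i f₂) = b₂
  linear_combination (-A - t * b₁ - t * b₁ * u * v + t * A * b₂ * v) * hx1 -
    v ^ 2 * b₂ * (u * b₁ - A * b₂) * ht

theorem sum_stdAddChar_near_critical_point {p n s q : ℕ} [NeZero p] [NeZero q]
    (hq : q = p ^ (2 * s)) (hs : 1 ≤ s)
    (f₁ f₂ : MvPolynomial (Fin n) ℤ) (a : Fin n → ZMod q)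
    (hu : IsUnit (aeval a f₂))
    (hJ : IsUnit (Matrix.of fun i j => aeval a (pderiv j (gradNum f₁ f₂ i))).det)
    (ha : ∀ i, aeval a (gradNum f₁ f₂ i) = 0) :
    (∑ x : Fin n → ZMod q,
        if ∀ i, (p : ZMod q) ∣ x i - a i then
          ZMod.stdAddChar (aeval x f₁ * (aeval x f₂)⁻¹) else 0) =
      (p : ℂ) ^ (n * s) * ZMod.stdAddChar (aeval a f₁ * (aeval a f₂)⁻¹) := by
  set t : ZMod q := (p : ZMod q) ^ s with ht
  have hp0 : (p : ZMod q) ^ (2 * s) = 0 := by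
    rw [← Nat.cast_pow, ← hq, ZMod.natCast_self]
  have ht2 : t ^ 2 = 0 := by rw [ht, ← pow_mul, mul_comm, hp0]
  have hpt : (p : ZMod q) ∣ t := dvd_pow_self _ (by omega)
  have hunit : ∀ x : Fin n → ZMod q, (∀ i, (p : ZMod q) ∣ x i - a i) → IsUnit (aeval x f₂) :=
    fun x hx => isUnit_of_dvd_sub ⟨_, hp0⟩ hu (dvd_aeval_sub_aeval f₂ hx)
  have hannih : ∀ y : ZMod q, t * y = 0 → t ∣ y := by
    intro y hy
    rw [ht, ← ZMod.natCast_zmod_val y, ← Nat.cast_pow, ← Nat.cast_mul,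
      ZMod.natCast_eq_zero_iff] at hy
    replace hy : p ^ s * p ^ s ∣ p ^ s * y.val := by rwa [← pow_add, ← two_mul, ← hq]
    have := Nat.dvd_of_mul_dvd_mul_left (pow_pos (NeZero.pos p) s) hy
    rw [ht, ← ZMod.natCast_zmod_val y, ← Nat.cast_pow]
    exact Nat.cast_dvd_cast this
  set G : (Fin n → ZMod q) → ℂ := fun x => if ∀ i, (p : ZMod q) ∣ x i - a i then
    ZMod.stdAddChar (aeval x f₁ * (aeval x f₂)⁻¹) else 0 with hG
  set b : (Fin n → ZMod q) → Fin n → ZMod q :=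
    fun x i => t * aeval x (gradNum f₁ f₂ i) * (aeval x f₂)⁻¹ ^ 2 with hb
  have hshift : ∀ x h : Fin n → ZMod q,
      G (fun i => x i + t * h i) = G x * ZMod.stdAddChar (∑ i, h i * b x i) := by
    intro x h
    have hiff : (∀ i, (p : ZMod q) ∣ x i + t * h i - a i) ↔ ∀ i, (p : ZMod q) ∣ x i - a i := by
      refine forall_congr' fun i => ?_
      rw [add_sub_right_comm]
      exact dvd_add_left (hpt.mul_right _)
    simp only [hG, hiff]
    split_ifs with hx
    · rw [ratio_aeval_add_mul f₁ f₂ ht2 (hunit x hx), AddChar.map_add_eq_mul]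
    · simp
  have hG' : ∀ x, (G x * if ∀ i, b x i = 0 then (q : ℂ) ^ n else 0) =
      (q : ℂ) ^ n * if ∀ i, t ∣ x i - a i then
        ZMod.stdAddChar (aeval a f₁ * (aeval a f₂)⁻¹) else 0 := by
    intro x
    by_cases hx : ∀ i, t ∣ x i - a i
    · have hxp : ∀ i, (p : ZMod q) ∣ x i - a i := fun i => hpt.trans (hx i)
      have hb0 : ∀ i, b x i = 0 := by
        intro i
        obtain ⟨c, hc⟩ := dvd_aeval_sub_aeval (gradNum f₁ f₂ i) hx
        rw [ha i, sub_zero] at hc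
        simp only [hb, hc]
        linear_combination c * (aeval x f₂)⁻¹ ^ 2 * ht2
      rw [if_pos hb0, if_pos hx, mul_comm]
      obtain ⟨h, rfl⟩ := exists_eq_add_mul hx
      simp only [hG]
      rw [if_pos hxp, ratio_aeval_add_mul f₁ f₂ ht2 hu]
      simp [ha]
    · rw [if_neg hx, mul_zero]
      by_cases hxp : ∀ i, (p : ZMod q) ∣ x i - a i
      · rw [if_neg, mul_zero]
        intro hb0
        refine hx (pow_dvd_sub_of_pow_dvd_aeval (gradNum f₁ f₂) hJ ha hxp fun i => hannih _ ?_)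
        have hv : IsUnit ((aeval x f₂)⁻¹ ^ 2) :=
          (IsUnit.of_mul_eq_one_right _ (ZMod.mul_inv_of_unit _ (hunit x hxp))).pow 2
        exact (hv.mul_left_eq_zero).1 (hb0 i)
      · simp only [hG]
        rw [if_neg hxp, zero_mul]
  have hcard : (Finset.univ.filter fun x : Fin n → ZMod q => ∀ i, t ∣ x i - a i).card =
      p ^ (n * s) := by
    have : (Finset.univ.filter fun x : Fin n → ZMod q => ∀ i, t ∣ x i - a i) =
        Fintype.piFinset fun i => Finset.univ.filter fun y : ZMod q => t ∣ y - a i := by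
      ext x; simp
    rw [this, Fintype.card_piFinset]
    simp only [ht, card_filter_pow_dvd_sub hq (NeZero.ne p)]
    simp [← pow_mul, mul_comm]
  have hqn : (q : ℂ) ^ n ≠ 0 :=
    pow_ne_zero _ (Nat.cast_ne_zero.2 (NeZero.ne _))
  refine mul_left_cancel₀ hqn ?_
  calc (q : ℂ) ^ n * ∑ x, G x
      = ∑ h : Fin n → ZMod q, ∑ x : Fin n → ZMod q, G (fun i => x i + t * h i) := by
        have (h : Fin n → ZMod q) :
            ∑ x : Fin n → ZMod q, G (fun i => x i + t * h i) = ∑ x, G x :=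
          Equiv.sum_comp (Equiv.addRight fun i => t * h i) G
        simp [this, ZMod.card]
    _ = ∑ x, G x * ∑ h : Fin n → ZMod q, ZMod.stdAddChar (∑ i, h i * b x i) := by
        rw [Finset.sum_comm]
        simp only [hshift, Finset.mul_sum]
    _ = (q : ℂ) ^ n *
          ((p : ℂ) ^ (n * s) * ZMod.stdAddChar (aeval a f₁ * (aeval a f₂)⁻¹)) := by
        simp only [sum_stdAddChar_sum_mul, Fintype.card_fin, hG']
        rw [← Finset.mul_sum, ← Finset.sum_filter, Finset.sum_const, hcard]
        simp

theorem intCast_eval {σ R : Type*} [CommRing R] (g : MvPolynomial σ ℤ) (y : σ → ℤ) :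
    ((eval y g : ℤ) : R) = aeval (fun i => (y i : R)) g := by
  simpa [aeval_eq_eval, Function.comp_def] using (aeval_algebraMap_apply R y g).symm

theorem ZMod.natCast_dvd_intCast_iff {p q : ℕ} (hpq : p ∣ q) (k : ℤ) :
    (p : ZMod q) ∣ (k : ZMod q) ↔ (p : ℤ) ∣ k := by
  constructor
  · rintro ⟨c, hc⟩
    have h := congrArg (ZMod.castHom hpq (ZMod p)) hc
    rw [map_mul, map_natCast, map_intCast, ZMod.natCast_self, zero_mul] at h
    exact (ZMod.intCast_zmod_eq_zero_iff_dvd k p).1 h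
  · intro h
    simpa using map_dvd (Int.castRingHom (ZMod q)) h

theorem dvd_eval_hesseNum {p n : ℕ} {f₁ f₂ : MvPolynomial (Fin n) ℤ} {i : Fin n}
    (h : ∀ d, (p : ℤ) ∣ (gradNum f₁ f₂ i).coeff d) (x : Fin n → ℤ) (j : Fin n) :
    (p : ℤ) ∣ eval x (hesseNum f₁ f₂ i j) := by
  obtain ⟨g, hg⟩ := (C_dvd_iff_dvd_coeff _ _).2 h
  refine ⟨eval x (f₂ * pderiv j g - 2 * g * pderiv j f₂), ?_⟩
  rw [hesseNum, hg]
  simp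
  ring

theorem dvd_det_of_dvd {n : ℕ} (hn : 1 ≤ n) {k : ℤ} {A : Matrix (Fin n) (Fin n) ℤ}
    (h : ∀ i j, k ∣ A i j) : k ∣ A.det := by
  rw [Matrix.det_apply]
  refine Finset.dvd_sum fun σ _ => ?_
  rw [Units.smul_def, smul_eq_mul]
  refine Dvd.dvd.mul_left ?_ _
  exact (h _ _).trans (Finset.dvd_prod_of_mem _ (Finset.mem_univ (⟨0, hn⟩ : Fin n)))

/-- Theorem 1 (ii), case `m - r` even: for an odd prime `p`, a non-constant rational
function `f = f₁/f₂` whose numerator and denominator are coprime mod `p`,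
`r = min_i ord_p(∂f/∂xᵢ)`, `m - r = 2s ≥ 2`: if `α` is a critical point of `f` mod `p`
(`p^{-r}∇f(α) ≡ 0 (mod p)`) at which the Hessian of `f` is non-singular mod `p`, then
`S_α(f, p^m) = p^{n(m+r)/2} e_{p^m}(f(α*))`, where `α*` is the (unique) lifting of `α`
to a solution of `p^{-r}∇f(x) ≡ 0 (mod p^m)` with `α* ≡ α (mod p)`. -/
theorem stmt3 (p : ℕ) [NeZero p] (hp : p.Prime) (hodd : p ≠ 2)
    (n : ℕ) (hn : 1 ≤ n) (f₁ f₂ : MvPolynomial (Fin n) ℤ)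
    (hcop : IsRelPrime (f₁.map (Int.castRingHom (ZMod p))) (f₂.map (Int.castRingHom (ZMod p))))
    (hnc : ¬ ∃ a b : ℤ, b ≠ 0 ∧ (C b) * f₁ = (C a) * f₂)
    (m r s : ℕ)
    (hrle : ∀ i, r ≤ polyOrd p (gradNum f₁ f₂ i))
    (hrex : ∃ i, polyOrd p (gradNum f₁ f₂ i) = r)
    (hmr : r + 2 ≤ m) (hms : m = r + 2 * s)
    (α : Fin n → ℤ)
    (hcrit : ∀ i, (p : ℤ) ^ (r + 1) ∣ eval α (gradNum f₁ f₂ i))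
    (hhesse : ¬ (p : ℤ) ∣ Matrix.det (Matrix.of fun i j => eval α (hesseNum f₁ f₂ i j)))
    (αstar : Fin n → ℤ)
    (hlift : ∀ i, αstar i ≡ α i [ZMOD (p : ℤ)])
    (hstar : ∀ i, (p : ℤ) ^ (m + r) ∣ eval αstar (gradNum f₁ f₂ i)) :
    (∑ x : Fin n → ZMod (p ^ m),
        if (∀ i, ((x i).val : ℤ) ≡ α i [ZMOD (p : ℤ)]) ∧
            ¬ (p : ℤ) ∣ eval (fun i => ((x i).val : ℤ)) f₂ then
          eChar (p ^ m) (ratVal f₁ f₂ (p ^ m) (fun i => ((x i).val : ℤ)))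
        else 0)
      = (p : ℂ) ^ (n * (r + s)) * eChar (p ^ m) (ratVal f₁ f₂ (p ^ m) αstar) := by
  have hr : r = 0 := by
    by_contra hr
    refine hhesse (dvd_det_of_dvd hn fun i j => dvd_eval_hesseNum (fun d => ?_) α j)
    exact (dvd_pow_self _ hr).trans (pow_dvd_coeff_of_le_polyOrd (hrle i) d)
  subst hr
  rw [zero_add] at hms
  subst hms
  have hpdvd : p ∣ p ^ (2 * s) := dvd_pow_self p (by omega)
  have hpnil : IsNilpotent (p : ZMod (p ^ (2 * s))) := ⟨2 * s, by
    rw [← Nat.cast_pow]; exact ZMod.natCast_self _⟩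
  set a : Fin n → ZMod (p ^ (2 * s)) := fun i => (αstar i : ZMod (p ^ (2 * s))) with ha
  have hαa : ∀ i, (p : ZMod (p ^ (2 * s))) ∣ a i - (α i : ZMod (p ^ (2 * s))) := fun i => by
    rw [ha, ← Int.cast_sub, ZMod.natCast_dvd_intCast_iff hpdvd]
    exact (hlift i).symm.dvd
  have hN : ∀ i, aeval a (gradNum f₁ f₂ i) = 0 := fun i => by
    rw [ha, ← intCast_eval, ZMod.intCast_zmod_eq_zero_iff_dvd]
    simpa using hstar i
  have hdet : IsUnit (aeval a (Matrix.of fun i j => hesseNum f₁ f₂ i j).det) := by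
    refine isUnit_of_dvd_sub hpnil ?_ (dvd_aeval_sub_aeval _ hαa)
    rw [← intCast_eval, ZMod.coe_int_isUnit_iff_isCoprime, RingHom.map_det]
    push_cast
    exact ((Nat.prime_iff_prime_int.1 hp).coprime_iff_not_dvd.2 hhesse).pow_left
  have hdet' : aeval a (Matrix.of fun i j => hesseNum f₁ f₂ i j).det =
      aeval a f₂ ^ n * (Matrix.of fun i j => aeval a (pderiv j (gradNum f₁ f₂ i))).det := by
    have h := Matrix.det_smul (Matrix.of fun i j => aeval a (pderiv j (gradNum f₁ f₂ i)))
      (aeval a f₂)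
    rw [Fintype.card_fin] at h
    rw [AlgHom.map_det, ← h]
    congr 1
    ext i j
    simp [hesseNum, hN]
  rw [hdet', IsUnit.mul_iff, isUnit_pow_iff (by omega)] at hdet
  have hmain := sum_stdAddChar_near_critical_point rfl (by omega) f₁ f₂ a hdet.1 hdet.2 hN
  have hrat : ∀ y : Fin n → ℤ, ratVal f₁ f₂ (p ^ (2 * s)) y =
      aeval (fun i => (y i : ZMod (p ^ (2 * s)))) f₁ *
        (aeval (fun i => (y i : ZMod (p ^ (2 * s)))) f₂)⁻¹ := fun y => by
    rw [ratVal, intCast_eval, intCast_eval]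
  simp only [eChar_eq_stdAddChar, hrat, zero_add]
  rw [← hmain]
  refine Finset.sum_congr rfl fun x _ => ?_
  have hxval : (fun i => (((x i).val : ℤ) : ZMod (p ^ (2 * s)))) = x := by ext i; simp
  rw [hxval]
  have hiff : (∀ i, ((x i).val : ℤ) ≡ α i [ZMOD (p : ℤ)]) ↔
      ∀ i, (p : ZMod (p ^ (2 * s))) ∣ x i - a i := by
    refine forall_congr' fun i => ?_
    rw [show x i - a i = (((x i).val - αstar i : ℤ) : ZMod (p ^ (2 * s))) by simp [ha],
      ZMod.natCast_dvd_intCast_iff hpdvd, ← Int.modEq_iff_dvd]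
    exact ⟨fun h => (hlift i).trans h.symm, fun h => h.symm.trans (hlift i)⟩
  refine if_congr ⟨fun h => hiff.1 h.1, fun h => ⟨hiff.2 h, fun hdvd => ?_⟩⟩ rfl rfl
  have hunit : IsUnit (aeval x f₂) :=
    isUnit_of_dvd_sub hpnil hdet.1 (dvd_aeval_sub_aeval f₂ h)
  rw [← hxval, ← intCast_eval, ZMod.coe_int_isUnit_iff_isCoprime] at hunit
  push_cast at hunit
  rw [IsCoprime.pow_left_iff (by omega)] at hunit
  exact (Nat.prime_iff_prime_int.1 hp).coprime_iff_not_dvd.1 hunit hdvd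
end

section
/- Let p be an odd prime, n ≥ 1, and let f = f₁/f₂ be a non-constant rational function in n variables with f₁, f₂ ∈ ℤ[x₁,...,xₙ] whose reductions modulo p are coprime. Set r := min_{1≤i≤n} ord_p(∂f/∂xᵢ), assume m − r ≥ 2 and that m − r is odd. Suppose α ∈ ℤ^n satisfies p^{−r}∇f(α) ≡ 0 (mod p) and det(Hesse(f)(α)) ≢ 0 (mod p). Then S_α(f, p^m) = ( det(2̄ p^{−r} Hesse(f)(α*)) / p ) · p^{(m+r−1)n/2} · e_{p^m}(f(α*)) · G_p(1)^n, where (·/p) is the Legendre symbol, 2̄ is a multiplicative inverse of 2 modulo p^m, G_p(1) = Σ_{x=1}^{p} e_p(x²), and α* is the unique lifting of α to a solution of p^{−r}∇f(x) ≡ 0 (mod p^m) with α* ≡ α (mod p). -/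
open MvPolynomial

/-- The quadratic Gauss sum `G_p(1) = ∑_{x=1}^{p} e_p(x²)`. -/
noncomputable def gaussSumOne (p : ℕ) : ℂ :=
  ∑ x ∈ Finset.range p, eChar p (((x : ℤ) : ZMod p) ^ 2)

theorem MvPolynomial.pderiv_mul_X {σ R : Type*} [DecidableEq σ] [CommSemiring R] (i k : σ)
    (f : MvPolynomial σ R) :
    pderiv i (f * X k) = pderiv i f * X k + if i = k then f else 0 := by
  rw [pderiv_mul, pderiv_X, Pi.single_apply]
  by_cases h : i = k
  · simp [h]
  · simp [h, Ne.symm h]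

theorem MvPolynomial.pderiv_pderiv_comm {σ R : Type*} [CommRing R] (i j : σ)
    (F : MvPolynomial σ R) : pderiv i (pderiv j F) = pderiv j (pderiv i F) := by
  classical
  induction F using MvPolynomial.induction_on with
  | C b => simp
  | add f g hf hg => simp only [map_add, hf, hg]
  | mul_X f k hf =>
    simp only [pderiv_mul_X, map_add, hf, apply_ite (pderiv _), map_zero]
    ring

theorem MvPolynomial.sum_eval_pderiv_mul_X {σ R : Type*} [Fintype σ] [CommRing R]
    (f : MvPolynomial σ R) (a y : σ → R) (k : σ) :
    ∑ i, eval a (pderiv i (f * X k)) * y i =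
      a k * ∑ i, eval a (pderiv i f) * y i + eval a f * y k := by
  classical
  simp only [pderiv_mul_X, map_add, map_mul, eval_X, apply_ite (eval a), map_zero, add_mul,
    Finset.sum_add_distrib, Finset.mul_sum, ite_mul, zero_mul, Finset.sum_ite_eq',
    Finset.mem_univ, if_true]
  congr 1
  exact Finset.sum_congr rfl fun i _ => by ring

theorem MvPolynomial.sum_eval_pderiv_pderiv_mul_X {σ R : Type*} [Fintype σ] [CommRing R]
    (f : MvPolynomial σ R) (a y : σ → R) (k : σ) :
    ∑ i, ∑ j, eval a (pderiv j (pderiv i (f * X k))) * y i * y j =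
      a k * (∑ i, ∑ j, eval a (pderiv j (pderiv i f)) * y i * y j) +
        2 * y k * ∑ i, eval a (pderiv i f) * y i := by
  classical
  have e : ∀ i j, eval a (pderiv j (pderiv i (f * X k))) * y i * y j =
      a k * (eval a (pderiv j (pderiv i f)) * y i * y j) +
        (if j = k then eval a (pderiv i f) * y i * y j else 0) +
        (if i = k then eval a (pderiv j f) * y j * y i else 0) := by
    intro i j
    simp only [pderiv_mul_X, map_add, map_mul, eval_X, apply_ite (eval a),
      apply_ite (pderiv j), map_zero]
    split_ifs <;> ring
  simp only [e, Finset.sum_add_distrib, Finset.sum_ite_eq', Finset.mem_univ, if_true]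
  rw [Finset.sum_comm (f := fun i j => if i = k then eval a (pderiv j f) * y j * y i else 0)]
  simp only [Finset.sum_ite_eq', Finset.mem_univ, if_true, ← Finset.mul_sum, ← Finset.sum_mul]
  ring

/-- First-order Taylor expansion with remainder divisible by `t ^ 2`. -/
theorem MvPolynomial.exists_eval_add_mul {σ R : Type*} [Fintype σ] [CommRing R]
    (F : MvPolynomial σ R) (a y : σ → R) (t : R) :
    ∃ c, eval (fun i => a i + t * y i) F =
      eval a F + t * ∑ i, eval a (pderiv i F) * y i + t ^ 2 * c := by
  induction F using MvPolynomial.induction_on with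
  | C b => exact ⟨0, by simp⟩
  | add f g hf hg =>
    obtain ⟨c, hc⟩ := hf
    obtain ⟨d, hd⟩ := hg
    refine ⟨c + d, ?_⟩
    simp only [map_add, hc, hd, add_mul, Finset.sum_add_distrib]
    ring
  | mul_X f k hf =>
    obtain ⟨c, hc⟩ := hf
    refine ⟨c * (a k + t * y k) + y k * ∑ i, eval a (pderiv i f) * y i, ?_⟩
    rw [sum_eval_pderiv_mul_X, map_mul, hc, eval_X, map_mul, eval_X]
    ring

/-- Second-order Taylor expansion, multiplied by `2`, with remainder divisible by `t ^ 3`. -/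
theorem MvPolynomial.exists_two_mul_eval_add_mul {σ R : Type*} [Fintype σ] [CommRing R]
    (F : MvPolynomial σ R) (a y : σ → R) (t : R) :
    ∃ c, 2 * eval (fun i => a i + t * y i) F =
      2 * eval a F + 2 * t * ∑ i, eval a (pderiv i F) * y i +
        t ^ 2 * ∑ i, ∑ j, eval a (pderiv j (pderiv i F)) * y i * y j + t ^ 3 * c := by
  induction F using MvPolynomial.induction_on with
  | C b => exact ⟨0, by simp⟩
  | add f g hf hg =>
    obtain ⟨c, hc⟩ := hf
    obtain ⟨d, hd⟩ := hg
    refine ⟨c + d, ?_⟩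
    simp only [map_add, mul_add, hc, hd, add_mul, Finset.sum_add_distrib]
    ring
  | mul_X f k hf =>
    obtain ⟨c, hc⟩ := hf
    refine ⟨c * (a k + t * y k) +
      y k * ∑ i, ∑ j, eval a (pderiv j (pderiv i f)) * y i * y j, ?_⟩
    rw [sum_eval_pderiv_mul_X, sum_eval_pderiv_pderiv_mul_X, map_mul, ← mul_assoc, hc, eval_X,
      map_mul, eval_X]
    ring

theorem sum_pi_comp_eq_card_pow_mul {ι A B : Type*} [Fintype ι] [DecidableEq ι] [Fintype A]
    [DecidableEq B] (φ : ι → A → B) (T : ι → Finset B) (k : ℕ) (hmem : ∀ i a, φ i a ∈ T i)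
    (hfib : ∀ i, ∀ b ∈ T i, (Finset.univ.filter fun a => φ i a = b).card = k)
    (g : (ι → B) → ℂ) :
    ∑ y : ι → A, g (fun i => φ i (y i)) =
      (k : ℂ) ^ Fintype.card ι * ∑ z ∈ Fintype.piFinset T, g z := by
  rw [← Finset.sum_fiberwise_of_maps_to (t := Fintype.piFinset T)
    (g := fun (y : ι → A) i => φ i (y i))
    (fun y _ => Fintype.mem_piFinset.2 fun i => hmem i (y i)), Finset.mul_sum]
  refine Finset.sum_congr rfl fun z hz => ?_
  rw [Finset.sum_congr rfl (g := fun _ => g z)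
    fun y hy => congrArg g (Finset.mem_filter.1 hy).2, Finset.sum_const, nsmul_eq_mul]
  congr 1
  have : (Finset.univ.filter fun y : ι → A => (fun i => φ i (y i)) = z) =
      Fintype.piFinset fun i => Finset.univ.filter fun a => φ i a = z i := by
    ext y; simp [funext_iff]
  rw [this, Fintype.card_piFinset, Finset.prod_congr rfl
    fun i _ => hfib i (z i) (Fintype.mem_piFinset.1 hz i)]
  simp

theorem sum_addChar_mul_sq {F : Type*} [Field F] [Fintype F] [DecidableEq F]
    (hF : ringChar F ≠ 2) (ψ : AddChar F ℂ) (hψ : ψ.IsPrimitive) {c : F} (hc : c ≠ 0) :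
    ∑ x, ψ (c * x ^ 2) = (quadraticChar F c : ℂ) * ∑ x, ψ (x ^ 2) := by
  have key : ∀ c : F, c ≠ 0 → ∑ x, ψ (c * x ^ 2) =
      ∑ t, (quadraticChar F t : ℂ) * ψ (c * t) := by
    intro c hc
    rw [← Finset.sum_fiberwise (s := Finset.univ) (g := fun x : F => x ^ 2)]
    have : ∀ t : F, ∑ x with x ^ 2 = t, ψ (c * x ^ 2) =
        (quadraticChar F t : ℂ) * ψ (c * t) + ψ (t * c) := by
      intro t
      rw [Finset.sum_congr rfl (g := fun _ => ψ (c * t))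
        fun x hx => by rw [(Finset.mem_filter.1 hx).2], Finset.sum_const, nsmul_eq_mul]
      have h := quadraticChar_card_sqrts hF t
      have h' : ((Finset.univ.filter fun x : F => x ^ 2 = t).card : ℤ) =
          quadraticChar F t + 1 := by
        rw [← h]; congr 2; ext; simp
      have h'' : ((Finset.univ.filter fun x : F => x ^ 2 = t).card : ℂ) =
          quadraticChar F t + 1 := by exact_mod_cast h'
      rw [h'', mul_comm t c]; ring
    simp_rw [this]
    rw [Finset.sum_add_distrib, AddChar.sum_mulShift c hψ]
    simp [hc]
  have h1 := key 1 one_ne_zero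
  simp only [one_mul] at h1
  rw [key c hc, h1, ← Equiv.sum_comp (Equiv.mulLeft₀ c hc)
    fun t => (quadraticChar F t : ℂ) * ψ t, Finset.mul_sum]
  refine Finset.sum_congr rfl fun t _ => ?_
  have : quadraticChar F c * quadraticChar F c = 1 := by
    rw [← sq]; exact quadraticChar_sq_one hc
  have : (quadraticChar F c : ℂ) * quadraticChar F c = 1 := by exact_mod_cast this
  simp only [Equiv.mulLeft₀_apply, map_mul, Int.cast_mul]
  linear_combination (-(quadraticChar F t : ℂ) * ψ (c * t)) * this

theorem AddChar.map_sum_eq_prod_apply {ι A M : Type*} [Fintype ι] [AddCommMonoid A]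
    [CommMonoid M] (ψ : AddChar A M) (g : ι → A) : ψ (∑ i, g i) = ∏ i, ψ (g i) :=
  map_prod ψ.toMonoidHom (fun i => Multiplicative.ofAdd (g i)) Finset.univ

theorem sum_addChar_quadratic_form {F : Type*} [Field F] [Fintype F] [DecidableEq F]
    (hF : ringChar F ≠ 2) (ψ : AddChar F ℂ) (hψ : ψ.IsPrimitive) {n : ℕ}
    (M : Matrix (Fin n) (Fin n) F) (hM : M.IsSymm) (hdet : M.det ≠ 0) :
    ∑ z : Fin n → F, ψ (∑ i, ∑ j, M i j * z i * z j) =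
      (quadraticChar F M.det : ℂ) * (∑ x, ψ (x ^ 2)) ^ n := by
  have : Invertible (2 : F) := invertibleOfNonzero (Ring.two_ne_zero hF)
  obtain ⟨v, hv⟩ := LinearMap.BilinForm.exists_orthogonal_basis
    (B := Matrix.toBilin' M) (by
      refine ⟨fun x y => ?_⟩
      simp only [Matrix.toBilin'_apply, RingHom.id_apply]
      rw [Finset.sum_comm]
      refine Finset.sum_congr rfl fun i _ => Finset.sum_congr rfl fun j _ => ?_
      rw [hM.apply]; ring)
  have hfr : Module.finrank F (Fin n → F) = n := by simp
  let b : Module.Basis (Fin n) F (Fin n → F) := v.reindex (finCongr hfr)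
  have hb : ∀ i j, i ≠ j → Matrix.toBilin' M (b i) (b j) = 0 := by
    intro i j hij
    simp only [b, Module.Basis.reindex_apply]
    exact hv (by simpa using hij)
  let P : Matrix (Fin n) (Fin n) F := (Matrix.of fun i j => b j i)
  let d : Fin n → F := fun i => Matrix.toBilin' M (b i) (b i)
  have hP : P.transpose * M * P = Matrix.diagonal d := by
    ext i j
    have : (P.transpose * M * P) i j = Matrix.toBilin' M (b i) (b j) := by
      simp only [Matrix.toBilin'_apply, Matrix.mul_apply, Matrix.transpose_apply, P,
        Matrix.of_apply, Finset.sum_mul]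
      rw [Finset.sum_comm]
    rw [this, Matrix.diagonal_apply]
    split_ifs with h
    · subst h; rfl
    · exact hb i j h
  have hPdet : P.det ≠ 0 := by
    have h1 : P = (Pi.basisFun F (Fin n)).toMatrix b := by
      ext i j; simp [P, Module.Basis.toMatrix_apply]
    have h2 : ((Pi.basisFun F (Fin n)).toMatrix b).det * (b.toMatrix (Pi.basisFun F (Fin n))).det = 1 := by
      rw [← Matrix.det_mul, Module.Basis.toMatrix_mul_toMatrix_flip, Matrix.det_one]
    rw [h1]
    exact left_ne_zero_of_mul_eq_one h2
  have hprod : ∏ i, d i = P.det ^ 2 * M.det := by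
    rw [← Matrix.det_diagonal, ← hP]
    simp only [Matrix.det_mul, Matrix.det_transpose]; ring
  have hd : ∀ i, d i ≠ 0 := by
    have : ∏ i, d i ≠ 0 := by rw [hprod]; exact mul_ne_zero (pow_ne_zero _ hPdet) hdet
    exact fun i => Finset.prod_ne_zero_iff.1 this i (Finset.mem_univ i)
  have hchar : quadraticChar F M.det = ∏ i, quadraticChar F (d i) := by
    rw [← map_prod, hprod, map_mul, map_pow, quadraticChar_sq_one hPdet, one_mul]
  rw [← Equiv.sum_comp b.equivFun.symm.toEquiv]
  have hform : ∀ z : Fin n → F,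
      ∑ i, ∑ j, M i j * (b.equivFun.symm z) i * (b.equivFun.symm z) j = ∑ i, d i * z i ^ 2 := by
    intro z
    have h1 : ∑ i, ∑ j, M i j * (b.equivFun.symm z) i * (b.equivFun.symm z) j =
        Matrix.toBilin' M (b.equivFun.symm z) (b.equivFun.symm z) := by
      rw [Matrix.toBilin'_apply]
      exact Finset.sum_congr rfl fun i _ => Finset.sum_congr rfl fun j _ => by ring
    rw [h1, Module.Basis.equivFun_symm_apply]
    simp only [map_sum, map_smul, LinearMap.sum_apply, LinearMap.smul_apply, smul_eq_mul]
    refine Finset.sum_congr rfl fun i _ => ?_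
    rw [Finset.sum_eq_single i]
    · simp only [d]; ring
    · intro j _ hj; simp [hb _ _ hj]
    · simp
  simp only [LinearEquiv.coe_toEquiv, hform, AddChar.map_sum_eq_prod_apply]
  rw [← Fintype.prod_sum fun i x => ψ (d i * x ^ 2)]
  simp only [sum_addChar_mul_sq hF ψ hψ (hd _), Finset.prod_mul_distrib, hchar, Int.cast_prod]
  simp

/-- Averaging over translations by `t`-multiples, with `t ^ 2 = 0`, localises an exponential sum
at the points where `t` kills the gradient. -/
theorem sum_addChar_eval_localize {ι R : Type*} [Fintype ι] [DecidableEq ι] [CommRing R]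
    [Fintype R] [DecidableEq R] (ψ : AddChar R ℂ) (hψ : ψ.IsPrimitive) (F : MvPolynomial ι R)
    {t : R} (ht : t ^ 2 = 0) (P : (ι → R) → Prop) [DecidablePred P]
    (hP : ∀ x v : ι → R, P (fun i => x i + t * v i) ↔ P x) :
    ∑ x, (if P x then ψ (eval x F) else 0) =
      ∑ x, if P x ∧ ∀ i, t * eval x (pderiv i F) = 0 then ψ (eval x F) else 0 := by
  have hshift : ∀ v : ι → R, ∑ x, (if P x then ψ (eval x F) else 0) =
      ∑ x, if P x then ψ (eval x F) * ∏ i, ψ (v i * (t * eval x (pderiv i F))) else 0 := by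
    intro v
    rw [← Equiv.sum_comp (Equiv.addRight fun i => t * v i)]
    refine Finset.sum_congr rfl fun x _ => ?_
    have hx : Equiv.addRight (fun i => t * v i) x = fun i => x i + t * v i := rfl
    obtain ⟨c, hc⟩ := exists_eval_add_mul F x v t
    rw [hx, if_congr (hP x v) rfl rfl, hc, ht, zero_mul, add_zero, AddChar.map_add_eq_mul,
      Finset.mul_sum, AddChar.map_sum_eq_prod_apply]
    simp only [mul_left_comm, mul_comm]
  have hcard : (Fintype.card (ι → R) : ℂ) ≠ 0 := Nat.cast_ne_zero.2 Fintype.card_ne_zero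
  refine mul_left_cancel₀ hcard ?_
  have hsum : ∑ _v : ι → R, ∑ x, (if P x then ψ (eval x F) else 0) =
      Fintype.card (ι → R) * ∑ x, (if P x then ψ (eval x F) else 0) := by
    rw [Finset.sum_const, nsmul_eq_mul, Finset.card_univ]
  rw [← hsum, Finset.sum_congr rfl fun v _ => hshift v, Finset.sum_comm, Finset.mul_sum]
  refine Finset.sum_congr rfl fun x _ => ?_
  by_cases hx : P x
  · simp only [hx, if_true, true_and]
    rw [← Finset.mul_sum, ← Fintype.prod_sum fun i u => ψ (u * (t * eval x (pderiv i F)))]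
    simp only [AddChar.sum_mulShift _ hψ]
    split_ifs with h
    · simp [h, mul_comm]
    · push Not at h
      obtain ⟨i, hi⟩ := h
      rw [Finset.prod_eq_zero (Finset.mem_univ i) (by simp [hi]), mul_zero, mul_zero]
  · simp [hx]

theorem ZMod.natCast_prime_pow_self (p k : ℕ) : (p : ZMod (p ^ k)) ^ k = 0 := by
  exact_mod_cast ZMod.natCast_self (p ^ k)

theorem ZMod.dvd_of_pow_mul_eq_zero {p : ℕ} [Fact p.Prime] {k : ℕ} {y : ZMod (p ^ (k + 1))}
    (h : (p : ZMod (p ^ (k + 1))) ^ k * y = 0) : (p : ZMod (p ^ (k + 1))) ∣ y := by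
  have hp : 0 < p ^ k := pow_pos (Fact.out : p.Prime).pos k
  have h' : ((p ^ k * y.val : ℕ) : ZMod (p ^ (k + 1))) = 0 := by
    push_cast
    rw [ZMod.natCast_zmod_val, h]
  rw [ZMod.natCast_eq_zero_iff] at h'
  obtain ⟨z, hz⟩ := Nat.dvd_of_mul_dvd_mul_left hp ((pow_succ p k).symm.dvd.trans h')
  refine ⟨z, ?_⟩
  rw [← ZMod.natCast_zmod_val y, hz]
  push_cast
  rfl

/-- Uniqueness in Hensel's lemma: approximate critical points near a non-degenerate critical
point `a` are close to `a`. -/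
theorem exists_eq_add_pow_mul_of_gradient {p : ℕ} [Fact p.Prime] {s n : ℕ}
    (F : MvPolynomial (Fin n) (ZMod (p ^ (2 * s + 1)))) (a x : Fin n → ZMod (p ^ (2 * s + 1)))
    (hgrad : ∀ i, eval a (pderiv i F) = 0)
    (hdet : IsUnit (Matrix.det (Matrix.of fun i j => eval a (pderiv j (pderiv i F)))))
    (hx : ∀ i, ∃ y, x i = a i + p * y)
    (hx' : ∀ i, (p : ZMod (p ^ (2 * s + 1))) ^ (s + 1) * eval x (pderiv i F) = 0)
    {k : ℕ} (hk : 1 ≤ k) (hks : k ≤ s) : ∀ i, ∃ y, x i = a i + p ^ k * y := by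
  induction k, hk using Nat.le_induction with
  | base => simpa using hx
  | succ k hk ih =>
    choose y hy using ih (by omega)
    set q : ZMod (p ^ (2 * s + 1)) := (p : ZMod (p ^ (2 * s + 1))) with hq
    set H : Matrix (Fin n) (Fin n) (ZMod (p ^ (2 * s + 1))) :=
      Matrix.of fun i j => eval a (pderiv j (pderiv i F)) with hH
    have hH' : H⁻¹ * H = 1 := Matrix.nonsing_inv_mul _ hdet
    have hqm : ∀ e, 2 * s + 1 ≤ e → q ^ e = 0 := fun e he =>
      pow_eq_zero_of_le he (ZMod.natCast_prime_pow_self p _)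
    have hHy : q ^ (2 * s) • H.mulVec y = 0 := by
      ext i
      obtain ⟨c, hc⟩ := exists_eval_add_mul (pderiv i F) a y (q ^ k)
      have h := hx' i
      rw [show x = fun i => a i + q ^ k * y i from funext hy, hc, hgrad i] at h
      have h0 : q ^ (2 * s - (s + 1 + k)) * (q ^ (s + 1) *
          (0 + q ^ k * ∑ j, eval a (pderiv j (pderiv i F)) * y j + (q ^ k) ^ 2 * c)) = 0 := by
        rw [h, mul_zero]
      have e1 : q ^ (2 * s) = q ^ (2 * s - (s + 1 + k)) * q ^ (s + 1) * q ^ k := by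
        rw [← pow_add, ← pow_add]; congr 1; omega
      have e2 : q ^ (2 * s - (s + 1 + k)) * q ^ (s + 1) * (q ^ k) ^ 2 = 0 := by
        rw [← pow_add, ← pow_mul, ← pow_add]; exact hqm _ (by omega)
      simp only [Pi.smul_apply, Matrix.mulVec, dotProduct, hH, Matrix.of_apply, smul_eq_mul,
        Pi.zero_apply]
      linear_combination h0 - c * e2 + (∑ j, eval a (pderiv j (pderiv i F)) * y j) * e1
    have hyq : q ^ (2 * s) • y = 0 := by
      have := congrArg H⁻¹.mulVec hHy
      rwa [Matrix.mulVec_smul, Matrix.mulVec_mulVec, hH', Matrix.one_mulVec,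
        Matrix.mulVec_zero] at this
    intro i
    obtain ⟨z, hz⟩ := ZMod.dvd_of_pow_mul_eq_zero (p := p) (congrFun hyq i)
    refine ⟨z, ?_⟩
    rw [hy i, hz, ← hq]
    ring

theorem ZMod.stdAddChar_pow_mul {p : ℕ} [Fact p.Prime] (k : ℕ) (y : ZMod (p ^ (k + 1))) :
    ZMod.stdAddChar ((p : ZMod (p ^ (k + 1))) ^ k * y) =
      ZMod.stdAddChar (ZMod.castHom (dvd_pow_self p k.succ_ne_zero) (ZMod p) y) := by
  have hp : (p : ℂ) ≠ 0 := Nat.cast_ne_zero.2 (Fact.out : p.Prime).ne_zero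
  obtain ⟨y, rfl⟩ := ZMod.intCast_surjective y
  have h : (p : ZMod (p ^ (k + 1))) ^ k * (y : ZMod (p ^ (k + 1))) =
      ((p ^ k * y : ℤ) : ZMod (p ^ (k + 1))) := by push_cast; rfl
  rw [h, map_intCast (ZMod.castHom (dvd_pow_self p k.succ_ne_zero) (ZMod p)), ZMod.stdAddChar_coe, ZMod.stdAddChar_coe]
  congr 1
  push_cast
  field_simp
  ring

theorem ZMod.card_fiber_castHom {p : ℕ} [Fact p.Prime] (k : ℕ) (b : ZMod p) :
    (Finset.univ.filter fun a : ZMod (p ^ (k + 1)) =>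
      ZMod.castHom (dvd_pow_self p k.succ_ne_zero) (ZMod p) a = b).card = p ^ k := by
  have hsurj : Function.Surjective (ZMod.castHom (dvd_pow_self p k.succ_ne_zero) (ZMod p)) :=
    ZMod.ringHom_surjective _
  have hconst : ∀ b' : ZMod p, (Finset.univ.filter fun a : ZMod (p ^ (k + 1)) =>
      ZMod.castHom (dvd_pow_self p k.succ_ne_zero) (ZMod p) a = b').card =
      (Finset.univ.filter fun a : ZMod (p ^ (k + 1)) =>
      ZMod.castHom (dvd_pow_self p k.succ_ne_zero) (ZMod p) a = b).card := fun b' =>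
    AddMonoidHom.card_fiber_eq_of_mem_range
      (ZMod.castHom (dvd_pow_self p k.succ_ne_zero) (ZMod p)) (hsurj b') (hsurj b)
  have hsum := Finset.card_eq_sum_card_fiberwise (s := (Finset.univ : Finset (ZMod (p ^ (k + 1)))))
    (t := Finset.univ) (f := ZMod.castHom (dvd_pow_self p k.succ_ne_zero) (ZMod p))
    (fun _ _ => by simp)
  simp only [hconst, Finset.sum_const, Finset.card_univ, ZMod.card, smul_eq_mul] at hsum
  exact (Nat.eq_of_mul_eq_mul_left (Fact.out : p.Prime).pos ((pow_succ' p k).symm.trans hsum)).symm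

theorem ZMod.card_fiber_add_pow_mul {p : ℕ} [Fact p.Prime] {s m : ℕ} (hs : s ≤ m)
    (a y : ZMod (p ^ m)) :
    (Finset.univ.filter fun z : ZMod (p ^ m) => a + p ^ s * z = a + p ^ s * y).card = p ^ s := by
  have h := IsAddCyclic.card_nsmulAddMonoidHom_ker (ZMod (p ^ m)) (p ^ s)
  rw [Nat.card_zmod, Nat.gcd_eq_right (pow_dvd_pow p hs)] at h
  rw [← h, Nat.card_eq_fintype_card, Fintype.card_of_subtype
    (Finset.univ.filter fun z : ZMod (p ^ m) => nsmulAddMonoidHom (p ^ s) z = 0)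
    (fun x => by simp [AddMonoidHom.mem_ker])]
  rw [← AddMonoidHom.card_fiber_eq_of_mem_range (nsmulAddMonoidHom (p ^ s) : ZMod (p ^ m) →+ _)
    (x := nsmulAddMonoidHom (p ^ s) y) ⟨y, rfl⟩ ⟨0, map_zero _⟩]
  congr 1
  ext z
  simp

theorem sum_stdAddChar_eval_near_critical {p : ℕ} [Fact p.Prime] (hodd : p ≠ 2) {s n : ℕ}
    (hs : 1 ≤ s) (F : MvPolynomial (Fin n) (ZMod (p ^ (2 * s + 1))))
    (a : Fin n → ZMod (p ^ (2 * s + 1))) (hgrad : ∀ i, eval a (pderiv i F) = 0)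
    (hdet : IsUnit (Matrix.det (Matrix.of fun i j => eval a (pderiv j (pderiv i F)))))
    {c : ZMod (p ^ (2 * s + 1))} (hc : 2 * c = 1)
    (P : (Fin n → ZMod (p ^ (2 * s + 1))) → Prop) [DecidablePred P]
    (hP : ∀ x, P x ↔ ∀ i, ∃ y, x i = a i + p * y) :
    ∑ x, (if P x then ZMod.stdAddChar (eval x F) else 0) =
      (quadraticChar (ZMod p) (Matrix.det (Matrix.of fun i j =>
        ZMod.castHom (dvd_pow_self p (2 * s).succ_ne_zero) (ZMod p)
          (c * eval a (pderiv j (pderiv i F))))) : ℂ) * p ^ (n * s) *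
        ZMod.stdAddChar (eval a F) * (∑ x : ZMod p, ZMod.stdAddChar (x ^ 2)) ^ n := by
  classical
  set π := ZMod.castHom (dvd_pow_self p (2 * s).succ_ne_zero) (ZMod p) with hπ
  set q : ZMod (p ^ (2 * s + 1)) := (p : ZMod (p ^ (2 * s + 1))) with hq
  have hqm : ∀ e, 2 * s + 1 ≤ e → q ^ e = 0 := fun e he =>
    pow_eq_zero_of_le he (ZMod.natCast_prime_pow_self p _)
  have hloc := sum_addChar_eval_localize ZMod.stdAddChar (ZMod.isPrimitive_stdAddChar _) F
    (t := q ^ (s + 1)) (by rw [← pow_mul]; exact hqm _ (by omega))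
    P (by
      intro x v
      rw [hP, hP]
      refine forall_congr' fun i => ⟨fun ⟨y, hy⟩ => ⟨y - q ^ s * v i, ?_⟩,
        fun ⟨y, hy⟩ => ⟨y + q ^ s * v i, ?_⟩⟩
      · linear_combination hy
      · linear_combination hy)
  rw [hloc]
  let T : Fin n → Finset (ZMod (p ^ (2 * s + 1))) := fun i =>
    Finset.univ.image fun y => a i + q ^ s * y
  have hset : ∀ x : Fin n → ZMod (p ^ (2 * s + 1)),
      (P x ∧ ∀ i, q ^ (s + 1) * eval x (pderiv i F) = 0) ↔
        x ∈ Fintype.piFinset T := by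
    intro x
    simp only [hP, Fintype.mem_piFinset, T, Finset.mem_image, Finset.mem_univ, true_and]
    constructor
    · rintro ⟨h1, h2⟩ i
      obtain ⟨y, hy⟩ := exists_eq_add_pow_mul_of_gradient F a x hgrad hdet h1 h2 hs le_rfl i
      exact ⟨y, hy.symm⟩
    · intro h
      choose y hy using h
      refine ⟨fun i => ⟨q ^ (s - 1) * y i, ?_⟩, fun i => ?_⟩
      · rw [← hy i, ← mul_assoc, ← pow_succ', Nat.sub_add_cancel hs]
      · obtain ⟨d, hd⟩ := exists_eval_add_mul (pderiv i F) a y (q ^ s)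
        rw [← funext hy, hd, hgrad i]
        linear_combination (∑ j, eval a (pderiv j (pderiv i F)) * y j + q ^ s * d) *
          hqm (2 * s + 1) le_rfl
  simp only [hset]
  rw [← Finset.sum_filter, Finset.filter_mem_eq_inter, Finset.univ_inter]
  have hpar := sum_pi_comp_eq_card_pow_mul (fun i y => a i + q ^ s * y) T (p ^ s)
    (fun i y => Finset.mem_image_of_mem _ (Finset.mem_univ y))
    (fun i b hb => by
      obtain ⟨y, -, rfl⟩ := Finset.mem_image.1 hb
      exact ZMod.card_fiber_add_pow_mul (by omega) (a i) y)
    (fun x => ZMod.stdAddChar (eval x F))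
  let M : Matrix (Fin n) (Fin n) (ZMod p) :=
    Matrix.of fun i j => π (c * eval a (pderiv j (pderiv i F)))
  have hval : ∀ y : Fin n → ZMod (p ^ (2 * s + 1)),
      ZMod.stdAddChar (eval (fun i => a i + q ^ s * y i) F) =
        ZMod.stdAddChar (eval a F) *
          ZMod.stdAddChar (∑ i, ∑ j, M i j * π (y i) * π (y j)) := by
    intro y
    obtain ⟨d, hd⟩ := exists_two_mul_eval_add_mul F a y (q ^ s)
    have h1 : eval (fun i => a i + q ^ s * y i) F = eval a F + q ^ (2 * s) *
        (c * ∑ i, ∑ j, eval a (pderiv j (pderiv i F)) * y i * y j) := by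
      have h3 : (q ^ s) ^ 3 = 0 := by rw [← pow_mul]; exact hqm _ (by omega)
      simp only [hgrad, zero_mul, Finset.sum_const_zero] at hd
      linear_combination c * hd - (eval (fun i => a i + q ^ s * y i) F - eval a F) * hc +
        c * d * h3
    rw [h1, AddChar.map_add_eq_mul, ZMod.stdAddChar_pow_mul, ← hπ]
    simp only [M, Matrix.of_apply, map_mul, map_sum, Finset.mul_sum, mul_assoc]
  have hdetM : M.det ≠ 0 := by
    have hM : M = π.mapMatrix (c • Matrix.of fun i j => eval a (pderiv j (pderiv i F))) := by
      ext i j; simp [M]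
    rw [hM, ← RingHom.map_det, Matrix.det_smul]
    have hcu : IsUnit c := IsUnit.of_mul_eq_one 2 ((mul_comm c 2).trans hc)
    exact (((hcu.pow _).mul hdet).map π).ne_zero
  have hquad := sum_addChar_quadratic_form (F := ZMod p) (by rwa [ZMod.ringChar_zmod_n])
    ZMod.stdAddChar (ZMod.isPrimitive_stdAddChar p) M (by
      ext i j; simp [M, pderiv_pderiv_comm i j]) hdetM
  have hred := sum_pi_comp_eq_card_pow_mul (fun (_ : Fin n) y => π y) (fun _ => Finset.univ)
    (p ^ (2 * s)) (fun i y => Finset.mem_univ _)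
    (fun i b _ => ZMod.card_fiber_castHom (2 * s) b)
    (fun z => ZMod.stdAddChar (∑ i, ∑ j, M i j * z i * z j))
  simp only [hval, ← Finset.mul_sum] at hpar
  rw [hred, Fintype.piFinset_univ, hquad] at hpar
  have hp : ((p ^ s : ℕ) : ℂ) ^ Fintype.card (Fin n) ≠ 0 := by
    exact_mod_cast pow_ne_zero _ (pow_ne_zero _ (Fact.out : p.Prime).ne_zero)
  refine mul_left_cancel₀ hp (hpar.symm.trans ?_)
  rw [Fintype.card_fin]
  push_cast
  ring

theorem gaussSumOne_eq_sum_stdAddChar (p : ℕ) [NeZero p] :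
    gaussSumOne p = ∑ x : ZMod p, ZMod.stdAddChar (x ^ 2) := by
  rw [gaussSumOne]
  refine Finset.sum_nbij' (fun x => (x : ZMod p)) ZMod.val (fun _ _ => Finset.mem_univ _)
    (fun x _ => Finset.mem_range.2 (ZMod.val_lt x))
    (fun x hx => ZMod.val_cast_of_lt (Finset.mem_range.1 hx))
    (fun x _ => ZMod.natCast_zmod_val x) fun x _ => ?_
  rw [eChar_eq_stdAddChar, Int.cast_natCast]

theorem intCast_eval_eq_eval_map {σ : Type*} (q : ℕ) (x : σ → ℤ) (f : MvPolynomial σ ℤ) :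
    ((eval x f : ℤ) : ZMod q) =
      eval (fun i => (x i : ZMod q)) (f.map (Int.castRingHom (ZMod q))) := by
  exact map_eval (Int.castRingHom (ZMod q)) x f

theorem map_eq_zero_of_polyOrd_pos {p n : ℕ} {g : MvPolynomial (Fin n) ℤ}
    (h : 0 < polyOrd p g) : g.map (Int.castRingHom (ZMod p)) = 0 := by
  have hbdd : BddAbove {k : ℕ | ∀ d, (p : ℤ) ^ k ∣ g.coeff d} := by
    by_contra hb
    rw [polyOrd, Nat.sSup_of_not_bddAbove hb] at h
    exact lt_irrefl _ h
  have hmem := Nat.sSup_mem (s := {k : ℕ | ∀ d, (p : ℤ) ^ k ∣ g.coeff d}) ⟨0, by simp⟩ hbdd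
  ext d
  rw [coeff_map, coeff_zero, eq_intCast, ZMod.intCast_zmod_eq_zero_iff_dvd]
  exact (dvd_pow_self _ h.ne').trans (hmem d)

theorem det_hesseNum_dvd_of_polyOrd_pos {p n : ℕ} (hn : 1 ≤ n) {f₁ f₂ : MvPolynomial (Fin n) ℤ}
    (h : ∀ i, 0 < polyOrd p (gradNum f₁ f₂ i)) (x : Fin n → ℤ) :
    (p : ℤ) ∣ Matrix.det (Matrix.of fun i j => eval x (hesseNum f₁ f₂ i j)) := by
  have : Nonempty (Fin n) := ⟨⟨0, hn⟩⟩
  rw [← ZMod.intCast_zmod_eq_zero_iff_dvd, Int.cast_det]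
  convert Matrix.det_zero (n := Fin n) (R := ZMod p)
  ext i j
  have hi := map_eq_zero_of_polyOrd_pos (h i)
  simp [intCast_eval_eq_eval_map, hesseNum, ← pderiv_map, hi]

theorem pderiv_mul_pow_eq {σ R : Type*} [CommRing R] (g u : MvPolynomial σ R) {K : ℕ}
    (hK : ((K + 3 : ℕ) : R) = 0) (i : σ) :
    pderiv i (g * u ^ (K + 2)) = u ^ (K + 1) * (u * pderiv i g - g * pderiv i u) := by
  have hK' : (K : MvPolynomial σ R) + 3 = 0 := by
    have h := congrArg (C (σ := σ)) hK
    rw [map_natCast, C_0] at h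
    exact_mod_cast h
  rw [pderiv_mul, pderiv_pow, show K + 2 - 1 = K + 1 by omega]
  push_cast
  linear_combination (g * u ^ (K + 1) * pderiv i u) * hK'

theorem pderiv_pderiv_mul_pow_eq {σ R : Type*} [CommRing R] (g u : MvPolynomial σ R) {K : ℕ}
    (hK : ((K + 3 : ℕ) : R) = 0) (i j : σ) :
    pderiv j (pderiv i (g * u ^ (K + 2))) =
      u ^ K * (u * pderiv j (u * pderiv i g - g * pderiv i u) -
        2 * (u * pderiv i g - g * pderiv i u) * pderiv j u) := by
  have hK' : (K : MvPolynomial σ R) + 3 = 0 := by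
    have h := congrArg (C (σ := σ)) hK
    rw [map_natCast, C_0] at h
    exact_mod_cast h
  rw [pderiv_mul_pow_eq g u hK, pderiv_mul (f := u ^ (K + 1)), pderiv_pow,
    show K + 1 - 1 = K by omega]
  push_cast
  linear_combination (u ^ K * (u * pderiv i g - g * pderiv i u) * pderiv j u) * hK'

theorem map_gradNum {n : ℕ} {R : Type*} [CommRing R] (φ : ℤ →+* R)
    (f₁ f₂ : MvPolynomial (Fin n) ℤ) (i : Fin n) :
    (gradNum f₁ f₂ i).map φ =
      f₂.map φ * pderiv i (f₁.map φ) - f₁.map φ * pderiv i (f₂.map φ) := by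
  simp [gradNum, pderiv_map]

theorem map_hesseNum {n : ℕ} {R : Type*} [CommRing R] (φ : ℤ →+* R)
    (f₁ f₂ : MvPolynomial (Fin n) ℤ) (i j : Fin n) :
    (hesseNum f₁ f₂ i j).map φ =
      f₂.map φ * pderiv j (f₂.map φ * pderiv i (f₁.map φ) - f₁.map φ * pderiv i (f₂.map φ)) -
        2 * (f₂.map φ * pderiv i (f₁.map φ) - f₁.map φ * pderiv i (f₂.map φ)) *
          pderiv j (f₂.map φ) := by
  rw [← map_gradNum, pderiv_map, pderiv_map, hesseNum]
  simp

/-- An exponent annihilating both the units of `ZMod (p ^ m)` and its additive group. -/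
theorem exists_exponent_zmod_prime_pow {p : ℕ} [Fact p.Prime] (hodd : p ≠ 2) {m : ℕ}
    (hm : 0 < m) : ∃ K : ℕ, ((K + 3 : ℕ) : ZMod (p ^ m)) = 0 ∧
      ∀ u : ZMod (p ^ m), IsUnit u → u ^ (K + 3) = 1 := by
  have hp : p.Prime := Fact.out
  have hp3 : 3 ≤ p := by have := hp.two_le; omega
  have h3 : 3 ≤ p ^ m * (p - 1) :=
    calc 3 ≤ p := hp3
      _ ≤ p ^ m := Nat.le_self_pow hm.ne' p
      _ ≤ p ^ m * (p - 1) := Nat.le_mul_of_pos_right _ (by omega)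
  refine ⟨p ^ m * (p - 1) - 3, ?_, ?_⟩ <;> rw [Nat.sub_add_cancel h3]
  · rw [Nat.cast_mul, ZMod.natCast_self, zero_mul]
  · rintro _ ⟨u, rfl⟩
    have hN : p ^ m * (p - 1) = Nat.totient (p ^ m) * p := by
      rw [Nat.totient_prime_pow hp hm]
      obtain ⟨k, rfl⟩ := Nat.exists_eq_succ_of_ne_zero hm.ne'
      rw [Nat.succ_sub_one, pow_succ]
      ring
    rw [hN, pow_mul, ← Units.val_pow_eq_pow_val, ZMod.pow_totient, Units.val_one, one_pow]

theorem ZMod.isUnit_intCast_prime_pow {p : ℕ} [Fact p.Prime] (m : ℕ) {z : ℤ}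
    (hz : ¬ (p : ℤ) ∣ z) : IsUnit (z : ZMod (p ^ m)) := by
  have hp : Prime (p : ℤ) := Nat.prime_iff_prime_int.1 Fact.out
  rw [ZMod.coe_int_isUnit_iff_isCoprime]
  push_cast
  exact ((hp.coprime_iff_not_dvd).2 hz).pow_left

theorem ZMod.modEq_val_iff_exists {p : ℕ} [Fact p.Prime] {m : ℕ} (hm : m ≠ 0)
    (x : ZMod (p ^ m)) (b : ℤ) :
    (x.val : ℤ) ≡ b [ZMOD (p : ℤ)] ↔ ∃ y, x = (b : ZMod (p ^ m)) + p * y := by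
  constructor
  · intro h
    obtain ⟨z, hz⟩ := h.symm.dvd
    refine ⟨(z : ZMod (p ^ m)), ?_⟩
    have := congrArg (Int.cast : ℤ → ZMod (p ^ m)) hz
    push_cast at this
    rw [ZMod.natCast_zmod_val] at this
    linear_combination this
  · rintro ⟨y, hy⟩
    obtain ⟨z, rfl⟩ := ZMod.intCast_surjective y
    have h : ((x.val : ℤ) : ZMod (p ^ m)) = ((b + p * z : ℤ) : ZMod (p ^ m)) := by
      push_cast
      rw [ZMod.natCast_zmod_val, hy]
    rw [ZMod.intCast_eq_intCast_iff] at h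
    have hdvd : (p : ℤ) ∣ ((p ^ m : ℕ) : ℤ) := by
      push_cast
      exact dvd_pow_self _ hm
    have := h.of_dvd hdvd
    exact this.trans (by simp [Int.ModEq])

theorem eval_modEq_s4 {σ : Type*} {q : ℕ} {x y : σ → ℤ} (h : ∀ i, x i ≡ y i [ZMOD (q : ℤ)])
    (f : MvPolynomial σ ℤ) : eval x f ≡ eval y f [ZMOD (q : ℤ)] := by
  rw [← ZMod.intCast_eq_intCast_iff, intCast_eval_eq_eval_map, intCast_eval_eq_eval_map]
  congr 2
  exact funext fun i => (ZMod.intCast_eq_intCast_iff _ _ _).2 (h i)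

/-- Theorem 1 (ii), case `m - r` odd: for an odd prime `p`, a non-constant rational
function `f = f₁/f₂` whose numerator and denominator are coprime mod `p`,
`r = min_i ord_p(∂f/∂xᵢ)`, `m - r = 2s + 1 ≥ 2`: if `α` is a critical point of `f` mod `p`
at which the Hessian of `f` is non-singular mod `p`, then
`S_α(f, p^m) = (det(2̄ p^{-r} Hesse(f)(α*)) / p) · p^{(m+r-1)n/2} · e_{p^m}(f(α*)) · G_p(1)^n`,
where `α*` is the (unique) lifting of `α` to a solution of `p^{-r}∇f(x) ≡ 0 (mod p^m)`
with `α* ≡ α (mod p)`, `2̄` (`inv2`) is an inverse of `2` mod `p^m`, and the matrix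
`2̄ p^{-r} Hesse(f)(α*)` is represented mod `p^m` by
`inv2 * (hesseNum(α*)/p^r) * w³` with `w` an inverse of `f₂(α*)` mod `p^m`. -/
theorem stmt4 (p : ℕ) [Fact p.Prime] (hodd : p ≠ 2)
    (n : ℕ) (hn : 1 ≤ n) (f₁ f₂ : MvPolynomial (Fin n) ℤ)
    (hcop : IsRelPrime (f₁.map (Int.castRingHom (ZMod p))) (f₂.map (Int.castRingHom (ZMod p))))
    (hnc : ¬ ∃ a b : ℤ, b ≠ 0 ∧ (C b) * f₁ = (C a) * f₂)
    (m r s : ℕ)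
    (hrle : ∀ i, r ≤ polyOrd p (gradNum f₁ f₂ i))
    (hrex : ∃ i, polyOrd p (gradNum f₁ f₂ i) = r)
    (hmr : r + 2 ≤ m) (hms : m = r + 2 * s + 1)
    (α : Fin n → ℤ)
    (hcrit : ∀ i, (p : ℤ) ^ (r + 1) ∣ eval α (gradNum f₁ f₂ i))
    (hhesse : ¬ (p : ℤ) ∣ Matrix.det (Matrix.of fun i j => eval α (hesseNum f₁ f₂ i j)))
    (αstar : Fin n → ℤ)
    (hlift : ∀ i, αstar i ≡ α i [ZMOD (p : ℤ)])
    (hstar : ∀ i, (p : ℤ) ^ (m + r) ∣ eval αstar (gradNum f₁ f₂ i))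
    (inv2 w : ℤ)
    (hinv2 : 2 * inv2 ≡ 1 [ZMOD ((p : ℤ) ^ m)])
    (hw : eval αstar f₂ * w ≡ 1 [ZMOD ((p : ℤ) ^ m)]) :
    (∑ x : Fin n → ZMod (p ^ m),
        if (∀ i, ((x i).val : ℤ) ≡ α i [ZMOD (p : ℤ)]) ∧
            ¬ (p : ℤ) ∣ eval (fun i => ((x i).val : ℤ)) f₂ then
          eChar (p ^ m) (ratVal f₁ f₂ (p ^ m) (fun i => ((x i).val : ℤ)))
        else 0)
      = (legendreSym p
            (Matrix.det
              (Matrix.of fun i j => inv2 * (eval αstar (hesseNum f₁ f₂ i j) / (p : ℤ) ^ r) * w ^ 3)) : ℂ)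
          * (p : ℂ) ^ (n * (r + s)) * eChar (p ^ m) (ratVal f₁ f₂ (p ^ m) αstar)
          * (gaussSumOne p) ^ n := by
  have hp : p.Prime := Fact.out
  obtain rfl : r = 0 := by
    by_contra hr
    exact hhesse (det_hesseNum_dvd_of_polyOrd_pos hn
      (fun i => (Nat.pos_of_ne_zero hr).trans_le (hrle i)) α)
  obtain rfl : m = 2 * s + 1 := by omega
  have hs : 1 ≤ s := by omega
  obtain ⟨K, hK, hunit⟩ := exists_exponent_zmod_prime_pow hodd (Nat.succ_pos (2 * s))
  set R := ZMod (p ^ (2 * s + 1))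
  let φ := Int.castRingHom R
  let a : Fin n → R := fun i => αstar i
  let F : MvPolynomial (Fin n) R := f₁.map φ * f₂.map φ ^ (K + 2)
  have hcast : ∀ {x y : ℤ}, x ≡ y [ZMOD ((p : ℤ) ^ (2 * s + 1))] → (x : R) = (y : R) := by
    intro x y h
    exact (ZMod.intCast_eq_intCast_iff _ _ _).2 (by exact_mod_cast h)
  have hwR : eval a (f₂.map φ) * (w : R) = 1 := by
    have := hcast hw
    rwa [Int.cast_mul, Int.cast_one, intCast_eval_eq_eval_map] at this
  have h2R : 2 * (inv2 : R) = 1 := by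
    have := hcast hinv2
    push_cast at this
    exact this
  have hratVal : ∀ x : Fin n → ℤ, ¬ (p : ℤ) ∣ eval x f₂ →
      ratVal f₁ f₂ (p ^ (2 * s + 1)) x = eval (fun i => (x i : R)) F := by
    intro x hx
    have hu := hunit _ (ZMod.isUnit_intCast_prime_pow (2 * s + 1) hx)
    rw [ratVal, ZMod.inv_eq_of_mul_eq_one _ _ _ ((pow_succ' _ (K + 2)).symm.trans hu),
      intCast_eval_eq_eval_map, intCast_eval_eq_eval_map, map_mul, map_pow]
  have hp_dvd : (p : ℤ) ∣ (p : ℤ) ^ (2 * s + 1) := dvd_pow_self _ (by omega)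
  have hf₂ : ¬ (p : ℤ) ∣ eval αstar f₂ := by
    intro h
    have h1 : (p : ℤ) ∣ 1 := by
      have := (hw.of_dvd hp_dvd).dvd
      exact (dvd_sub_left (h.mul_right w)).1 this
    exact hp.one_lt.ne' (by exact_mod_cast Int.eq_one_of_dvd_one (by positivity) h1)
  have hmem : ∀ x : Fin n → R, ((∀ i, ((x i).val : ℤ) ≡ α i [ZMOD (p : ℤ)]) ∧
      ¬ (p : ℤ) ∣ eval (fun i => ((x i).val : ℤ)) f₂) ↔ ∀ i, ∃ y, x i = a i + p * y := by
    intro x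
    have h1 : (∀ i, ((x i).val : ℤ) ≡ α i [ZMOD (p : ℤ)]) ↔
        ∀ i, ((x i).val : ℤ) ≡ αstar i [ZMOD (p : ℤ)] :=
      forall_congr' fun i => ⟨fun h => h.trans (hlift i).symm, fun h => h.trans (hlift i)⟩
    have h2 : (∀ i, ((x i).val : ℤ) ≡ αstar i [ZMOD (p : ℤ)]) ↔
        ∀ i, ∃ y, x i = a i + p * y :=
      forall_congr' fun i => ZMod.modEq_val_iff_exists (by omega) (x i) (αstar i)
    rw [h1, ← h2]
    refine and_iff_left_of_imp fun h hdvd => hf₂ ?_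
    exact (eval_modEq_s4 h f₂).dvd_iff.1 hdvd
  have hgrad : ∀ i, eval a (pderiv i F) = 0 := by
    intro i
    have h0 : ((eval αstar (gradNum f₁ f₂ i) : ℤ) : R) = 0 :=
      (ZMod.intCast_zmod_eq_zero_iff_dvd _ _).2 (by exact_mod_cast hstar i)
    rw [intCast_eval_eq_eval_map, map_gradNum] at h0
    rw [pderiv_mul_pow_eq _ _ hK, map_mul, h0, mul_zero]
  have hhess : ∀ i j, eval a (pderiv j (pderiv i F)) =
      ((eval αstar (hesseNum f₁ f₂ i j) * w ^ 3 : ℤ) : R) := by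
    intro i j
    have hu := hunit (eval a (f₂.map φ)) (IsUnit.of_mul_eq_one _ hwR)
    have hw3 : eval a (f₂.map φ) ^ K = (w : R) ^ 3 := by
      have h3 : (eval a (f₂.map φ) * (w : R)) ^ 3 = 1 := by rw [hwR, one_pow]
      linear_combination (-(eval a (f₂.map φ)) ^ K) * h3 + (w : R) ^ 3 * hu
    rw [Int.cast_mul, intCast_eval_eq_eval_map, map_hesseNum, pderiv_pderiv_mul_pow_eq _ _ hK,
      map_mul, map_pow, hw3, Int.cast_pow, mul_comm]
  have hdet : IsUnit (Matrix.det (Matrix.of fun i j => eval a (pderiv j (pderiv i F)))) := by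
    have hmat : (Matrix.of fun i j => eval a (pderiv j (pderiv i F))) = (w : R) ^ 3 •
        (Matrix.of fun i j => eval αstar (hesseNum f₁ f₂ i j)).map (Int.cast : ℤ → R) := by
      ext i j
      simp [hhess, mul_comm]
    rw [hmat, Matrix.det_smul, ← Int.cast_det]
    refine (((IsUnit.of_mul_eq_one _ ((mul_comm _ _).trans hwR)).pow 3).pow _).mul
      (ZMod.isUnit_intCast_prime_pow _ fun h => hhesse ?_)
    rw [← ZMod.intCast_zmod_eq_zero_iff_dvd, Int.cast_det] at h ⊢
    rw [← h]
    congr 1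
    ext i j
    exact (ZMod.intCast_eq_intCast_iff _ _ _).2 (eval_modEq_s4 (fun i => (hlift i).symm) _)
  have hmain := sum_stdAddChar_eval_near_critical hodd hs F a hgrad hdet h2R
    (fun x => (∀ i, ((x i).val : ℤ) ≡ α i [ZMOD (p : ℤ)]) ∧
      ¬ (p : ℤ) ∣ eval (fun i => ((x i).val : ℤ)) f₂) hmem
  have hleg : legendreSym p (Matrix.det (Matrix.of fun i j =>
      inv2 * (eval αstar (hesseNum f₁ f₂ i j) / (p : ℤ) ^ 0) * w ^ 3)) =
      quadraticChar (ZMod p) (Matrix.det (Matrix.of fun i j =>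
        ZMod.castHom (dvd_pow_self p (2 * s).succ_ne_zero) (ZMod p)
          (inv2 * eval a (pderiv j (pderiv i F))))) := by
    rw [legendreSym, Int.cast_det]
    congr 2
    ext i j
    rw [Matrix.of_apply, hhess, ← Int.cast_mul, map_intCast]
    simp [mul_assoc]
  rw [hleg, gaussSumOne_eq_sum_stdAddChar, eChar_eq_stdAddChar, hratVal αstar hf₂, zero_add,
    ← hmain]
  refine Finset.sum_congr rfl fun x _ => ?_
  refine if_ctx_congr Iff.rfl (fun hx => ?_) fun _ => rfl
  rw [eChar_eq_stdAddChar, hratVal _ hx.2]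
  simp [R]
end

section
/- Let p be an odd prime, n ≥ 3, m ≥ 1, and A = (a_{ij}) a symmetric n×n integer matrix with gcd(det A, p) = 1. Then #{(x₁,...,xₙ) ∈ ℤ^n : 1 ≤ xᵢ ≤ p^m, (x₁,...,xₙ) ≢ (0,...,0) mod p, Σ_{i,j=1}^n a_{ij} xᵢ xⱼ ≡ 0 mod p^m} = p^{(n−1)(m−1)} · #{(x₁,...,xₙ) ∈ ℤ^n : 1 ≤ xᵢ ≤ p, (x₁,...,xₙ) ≢ (0,...,0) mod p, Σ_{i,j=1}^n a_{ij} xᵢ xⱼ ≡ 0 mod p}. -/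
open Matrix

/-- Mixed-radix digits: residues modulo `a * b` correspond to pairs of residues modulo `a` and `b`,
through `(y, z) ↦ y + a * z`. -/
theorem ZMod.exists_prod_equiv_val_eq (a b : ℕ) [NeZero a] [NeZero b] :
    ∃ e : ZMod a × ZMod b ≃ ZMod (a * b), ∀ w, (e w).val = w.1.val + a * w.2.val := by
  have hval (w : ZMod a × ZMod b) :
      ((w.1.val + a * w.2.val : ℕ) : ZMod (a * b)).val = w.1.val + a * w.2.val := by
    apply ZMod.val_cast_of_lt
    have h1 := ZMod.val_lt w.1
    have h2 : w.2.val + 1 ≤ b := ZMod.val_lt w.2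
    nlinarith [Nat.mul_le_mul_left a h2]
  have hinj : Function.Injective
      fun w : ZMod a × ZMod b => ((w.1.val + a * w.2.val : ℕ) : ZMod (a * b)) := by
    intro v w h
    have h' : v.1.val + a * v.2.val = w.1.val + a * w.2.val := by
      rw [← hval v, ← hval w]
      exact congrArg ZMod.val h
    have h1 : v.1.val = w.1.val := by
      have := congrArg (· % a) h'
      simpa [Nat.add_mul_mod_self_left, Nat.mod_eq_of_lt (ZMod.val_lt _)] using this
    have h2 : v.2.val = w.2.val := by
      rw [h1] at h'
      exact Nat.eq_of_mul_eq_mul_left (NeZero.pos a) (Nat.add_left_cancel h')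
    exact Prod.ext (ZMod.val_injective a h1) (ZMod.val_injective b h2)
  have hbij := (Fintype.bijective_iff_injective_and_card _).2 ⟨hinj, by simp [ZMod.card]⟩
  exact ⟨Equiv.ofBijective _ hbij, hval⟩

theorem Nat.card_subtype_prod_of_forall_card_eq {α β : Type*} [Finite α] [Finite β]
    (P : α → Prop) (R : α → β → Prop) (c : ℕ) (hc : ∀ a, P a → Nat.card {b // R a b} = c) :
    Nat.card {w : α × β // P w.1 ∧ R w.1 w.2} = Nat.card {a // P a} * c := by
  let e : {w : α × β // P w.1 ∧ R w.1 w.2} ≃ Σ a : {a // P a}, {b // R a b} :=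
    { toFun := fun w => ⟨⟨w.1.1, w.2.1⟩, ⟨w.1.2, w.2.2⟩⟩
      invFun := fun s => ⟨(s.1.1, s.2.1), s.1.2, s.2.2⟩
      left_inv := fun _ => rfl
      right_inv := fun _ => rfl }
  have := Fintype.ofFinite {a // P a}
  rw [Nat.card_congr e, Nat.card_sigma,
    Finset.sum_congr rfl fun (a : {a // P a}) _ => hc a a.2]
  simp

/-- An affine hyperplane in `F ^ ι` has `|F| ^ (|ι| - 1)` points. -/
theorem Nat.card_dotProduct_eq {F ι : Type*} [Field F] [Finite F] [Fintype ι]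
    {c : ι → F} (hc : c ≠ 0) (b : F) :
    Nat.card {z : ι → F // c ⬝ᵥ z = b} = Nat.card F ^ (Fintype.card ι - 1) := by
  classical
  obtain ⟨i, hi⟩ := Function.ne_iff.1 hc
  have hcard (b' : F) :
      Nat.card {z : ι → F // c ⬝ᵥ z = b'} = Nat.card {z : ι → F // c ⬝ᵥ z = b} := by
    refine Nat.card_congr ((Equiv.addRight (Pi.single i ((b - b') / c i))).subtypeEquiv fun z => ?_)
    have : c i * ((b - b') / c i) = b - b' := mul_div_cancel₀ _ hi
    simp only [Equiv.coe_addRight, dotProduct_add, dotProduct_single, this]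
    constructor <;> intro h
    · rw [h]; ring
    · linear_combination h
  have hfib : Nat.card (ι → F) = Nat.card F * Nat.card {z : ι → F // c ⬝ᵥ z = b} := by
    have := Fintype.ofFinite F
    rw [← Nat.card_congr (Equiv.sigmaFiberEquiv fun z : ι → F => c ⬝ᵥ z), Nat.card_sigma,
      Finset.sum_congr rfl fun b' _ => hcard b']
    simp
  have hpos : 0 < Fintype.card ι := Fintype.card_pos_iff.2 ⟨i⟩
  rw [Nat.card_fun, Nat.card_eq_fintype_card (α := ι), ← Nat.sub_add_cancel hpos, pow_succ'] at hfib
  exact (Nat.eq_of_mul_eq_mul_left Nat.card_pos hfib).symm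

theorem Matrix.IsSymm.dotProduct_mulVec_add_smul {R ι : Type*} [CommRing R] [Fintype ι]
    {A : Matrix ι ι R} (hA : A.IsSymm) (y z : ι → R) (t : R) :
    (y + t • z) ⬝ᵥ A *ᵥ (y + t • z)
      = y ⬝ᵥ A *ᵥ y + 2 * t * (A *ᵥ y ⬝ᵥ z) + t ^ 2 * (z ⬝ᵥ A *ᵥ z) := by
  have h : y ⬝ᵥ A *ᵥ z = A *ᵥ y ⬝ᵥ z := by
    rw [dotProduct_mulVec, ← mulVec_transpose, hA.eq]
  simp only [mulVec_add, mulVec_smul, add_dotProduct, dotProduct_add, smul_dotProduct,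
    dotProduct_smul, smul_eq_mul, h, dotProduct_comm z (A *ᵥ y)]
  ring

theorem Matrix.dotProduct_mulVec_eq_sum_sum {R ι : Type*} [CommRing R] [Fintype ι]
    (A : Matrix ι ι R) (x : ι → R) :
    x ⬝ᵥ A *ᵥ x = ∑ i, ∑ j, A i j * x i * x j := by
  simp only [dotProduct, mulVec, Finset.mul_sum]
  exact Finset.sum_congr rfl fun i _ => Finset.sum_congr rfl fun j _ => by ring

/-- Hensel-type linearization: `y + q z` is a zero of a quadratic form modulo `q p`, with `p ∣ q`,
if and only if `y` is a zero modulo `q` and `z` satisfies an affine equation modulo `p`. -/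
theorem Matrix.IsSymm.mul_dvd_dotProduct_mulVec_add_smul_iff {ι : Type*} [Fintype ι]
    {A : Matrix ι ι ℤ} (hA : A.IsSymm) {p q : ℕ} (hq : q ≠ 0) (hpq : p ∣ q) (y z : ι → ℤ) :
    ((q * p : ℕ) : ℤ) ∣ (y + (q : ℤ) • z) ⬝ᵥ A *ᵥ (y + (q : ℤ) • z) ↔
      (q : ℤ) ∣ y ⬝ᵥ A *ᵥ y ∧
        (fun i => ((2 * (A *ᵥ y) i : ℤ) : ZMod p)) ⬝ᵥ (fun i => (z i : ZMod p))
          = ((-(y ⬝ᵥ A *ᵥ y / q) : ℤ) : ZMod p) := by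
  have hdot : (fun i => ((2 * (A *ᵥ y) i : ℤ) : ZMod p)) ⬝ᵥ (fun i => (z i : ZMod p))
      = ((2 * (A *ᵥ y ⬝ᵥ z) : ℤ) : ZMod p) := by
    simp [dotProduct, Finset.mul_sum, mul_assoc]
  have hpq' : (p : ℤ) ∣ q := Int.natCast_dvd_natCast.2 hpq
  have hq0 : (q : ℤ) ≠ 0 := by exact_mod_cast hq
  rw [hA.dotProduct_mulVec_add_smul, hdot]
  have main (s : ℤ) (hs : y ⬝ᵥ A *ᵥ y = q * s) :
      ((q * p : ℕ) : ℤ) ∣ y ⬝ᵥ A *ᵥ y + 2 * q * (A *ᵥ y ⬝ᵥ z) + q ^ 2 * (z ⬝ᵥ A *ᵥ z) ↔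
        ((2 * (A *ᵥ y ⬝ᵥ z) : ℤ) : ZMod p) = ((-(y ⬝ᵥ A *ᵥ y / q) : ℤ) : ZMod p) := by
    rw [hs, Int.mul_ediv_cancel_left _ hq0, eq_comm, ZMod.intCast_eq_intCast_iff_dvd_sub,
      Nat.cast_mul,
      show (q : ℤ) * s + 2 * q * (A *ᵥ y ⬝ᵥ z) + q ^ 2 * (z ⬝ᵥ A *ᵥ z)
        = q * ((2 * (A *ᵥ y ⬝ᵥ z) - -s) + q * (z ⬝ᵥ A *ᵥ z)) by ring,
      mul_dvd_mul_iff_left hq0]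
    exact dvd_add_left (hpq'.mul_right _)
  constructor
  · intro h
    have hdvd : (q : ℤ) ∣ y ⬝ᵥ A *ᵥ y := by
      have h1 : (q : ℤ) ∣ y ⬝ᵥ A *ᵥ y + 2 * q * (A *ᵥ y ⬝ᵥ z) + q ^ 2 * (z ⬝ᵥ A *ᵥ z) :=
        Dvd.dvd.trans ⟨p, by push_cast; rfl⟩ h
      rw [add_assoc] at h1
      exact (dvd_add_left ⟨2 * (A *ᵥ y ⬝ᵥ z) + q * (z ⬝ᵥ A *ᵥ z), by ring⟩).1 h1
    obtain ⟨s, hs⟩ := hdvd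
    exact ⟨⟨s, hs⟩, (main s hs).1 h⟩
  · rintro ⟨⟨s, hs⟩, h⟩
    exact (main s hs).2 h

/-- The gradient of a quadratic form of discriminant prime to `p` does not vanish modulo the odd
prime `p` away from the origin. -/
theorem Matrix.two_mul_mulVec_intCast_ne_zero {ι : Type*} [Fintype ι] [DecidableEq ι] {p : ℕ}
    (hp : p.Prime) (hodd : p ≠ 2) {A : Matrix ι ι ℤ} (hdet : Int.gcd A.det (p : ℤ) = 1)
    {y : ι → ℤ} (hy : ¬ ∀ i, (p : ℤ) ∣ y i) :
    (fun i => ((2 * (A *ᵥ y) i : ℤ) : ZMod p)) ≠ 0 := by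
  have := Fact.mk hp
  intro h
  have h2 : (2 : ZMod p) ≠ 0 := by
    intro h2
    have : p ∣ 2 := (ZMod.natCast_eq_zero_iff 2 p).1 (by exact_mod_cast h2)
    exact hodd ((Nat.prime_dvd_prime_iff_eq hp Nat.prime_two).1 this)
  have hdet' : (A.map (Int.castRingHom (ZMod p))).det ≠ 0 := by
    have hmap : (A.map (Int.castRingHom (ZMod p))).det = (A.det : ZMod p) :=
      ((Int.castRingHom (ZMod p)).map_det A).symm
    rw [hmap, Ne, ZMod.intCast_zmod_eq_zero_iff_dvd]
    intro hd
    have := Int.dvd_coe_gcd hd dvd_rfl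
    rw [hdet] at this
    exact hp.one_lt.ne' (by exact_mod_cast Int.eq_one_of_dvd_one (by positivity) this)
  have hker : A.map (Int.castRingHom (ZMod p)) *ᵥ (fun i => (y i : ZMod p)) = 0 := by
    ext i
    have hi := congrFun h i
    simp only [Int.cast_mul, Int.cast_ofNat, Pi.zero_apply, mul_eq_zero, h2, false_or] at hi
    simpa [mulVec, dotProduct] using hi
  refine hy fun i => ?_
  rw [← ZMod.intCast_zmod_eq_zero_iff_dvd]
  exact congrFun (eq_zero_of_mulVec_eq_zero hdet' hker) i

/-- The number of zeros modulo `q` of the quadratic form of `A` which do not vanish modulo `p`. -/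
noncomputable def Matrix.primitiveZeroCount {ι : Type*} [Fintype ι] (A : Matrix ι ι ℤ)
    (p q : ℕ) : ℕ :=
  Nat.card {x : ι → ZMod q // (¬ ∀ i, (p : ℤ) ∣ ((x i).val : ℤ)) ∧
    (q : ℤ) ∣ ∑ i, ∑ j, A i j * ((x i).val : ℤ) * ((x j).val : ℤ)}

theorem Matrix.IsSymm.primitiveZeroCount_mul {ι : Type*} [Fintype ι] [DecidableEq ι] {p q : ℕ}
    (hp : p.Prime) (hodd : p ≠ 2) {A : Matrix ι ι ℤ} (hA : A.IsSymm)
    (hdet : Int.gcd A.det (p : ℤ) = 1) (hq : q ≠ 0) (hpq : p ∣ q) :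
    A.primitiveZeroCount p (q * p) = A.primitiveZeroCount p q * p ^ (Fintype.card ι - 1) := by
  have := Fact.mk hp
  have := NeZero.mk hq
  obtain ⟨e, he⟩ := ZMod.exists_prod_equiv_val_eq q p
  let f : (ι → ZMod q) × (ι → ZMod p) ≃ (ι → ZMod (q * p)) :=
    (Equiv.arrowProdEquivProdArrow ι (fun _ => ZMod q) fun _ => ZMod p).symm.trans
      (Equiv.piCongrRight fun _ => e)
  let lift (y : ι → ZMod q) (i : ι) : ℤ := (y i).val
  have hf (w) : (fun i => ((f w i).val : ℤ))
      = lift w.1 + (q : ℤ) • fun i => ((w.2 i).val : ℤ) := by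
    ext i
    change ((e (w.1 i, w.2 i)).val : ℤ) = _
    simp [he, lift]
  rw [primitiveZeroCount, primitiveZeroCount,
    ← Nat.card_subtype_prod_of_forall_card_eq (β := ι → ZMod p) _
      (fun y z => (fun i => ((2 * (A *ᵥ lift y) i : ℤ) : ZMod p)) ⬝ᵥ z
        = ((-(lift y ⬝ᵥ A *ᵥ lift y / q) : ℤ) : ZMod p))]
  · refine (Nat.card_congr (f.subtypeEquiv fun w => ?_)).symm
    have hprim (i) : (p : ℤ) ∣ ((f w i).val : ℤ) ↔ (p : ℤ) ∣ ((w.1 i).val : ℤ) := by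
      rw [congrFun (hf w) i]
      exact dvd_add_left ((Int.natCast_dvd_natCast.2 hpq).mul_right _)
    have hlin := hA.mul_dvd_dotProduct_mulVec_add_smul_iff hq hpq (lift w.1)
      fun i => ((w.2 i).val : ℤ)
    rw [← hf w] at hlin
    simp only [Int.cast_natCast, ZMod.natCast_zmod_val] at hlin
    rw [← dotProduct_mulVec_eq_sum_sum A (fun i => ((f w i).val : ℤ)),
      ← dotProduct_mulVec_eq_sum_sum A (fun i => ((w.1 i).val : ℤ)), hlin]
    simp only [hprim, and_assoc]
    rfl
  · rintro y ⟨hy, -⟩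
    rw [Nat.card_dotProduct_eq (two_mul_mulVec_intCast_ne_zero hp hodd hdet hy), Nat.card_zmod]

theorem Matrix.IsSymm.primitiveZeroCount_pow_succ {ι : Type*} [Fintype ι] [DecidableEq ι] {p : ℕ}
    (hp : p.Prime) (hodd : p ≠ 2) {A : Matrix ι ι ℤ} (hA : A.IsSymm)
    (hdet : Int.gcd A.det (p : ℤ) = 1) (k : ℕ) :
    A.primitiveZeroCount p (p ^ (k + 1))
      = p ^ ((Fintype.card ι - 1) * k) * A.primitiveZeroCount p p := by
  induction k with
  | zero => simp
  | succ k ih =>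
    rw [pow_succ, hA.primitiveZeroCount_mul hp hodd hdet (pow_ne_zero _ hp.ne_zero)
      (dvd_pow_self p k.succ_ne_zero), ih]
    ring

/-- The number of solutions `x mod p^m`, not all coordinates divisible by `p`, of
`Σ aᵢⱼxᵢxⱼ ≡ 0 mod p^m` (for a symmetric integer matrix `A` with `gcd(det A, p) = 1`,
`p` an odd prime, `n ≥ 3`, `m ≥ 1`) equals `p^{(n-1)(m-1)}` times the number of such
solutions modulo `p`. -/
theorem stmt6 (p : ℕ) [NeZero p] (hp : p.Prime) (hodd : p ≠ 2)
    (n : ℕ) (hn : 3 ≤ n) (m : ℕ) (hm : 1 ≤ m)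
    (A : Matrix (Fin n) (Fin n) ℤ) (hA : A.IsSymm) (hdet : Int.gcd A.det (p : ℤ) = 1) :
    Nat.card {x : Fin n → ZMod (p ^ m) //
        (¬ ∀ i, (p : ℤ) ∣ ((x i).val : ℤ)) ∧
        ((p : ℤ) ^ m ∣ ∑ i, ∑ j, A i j * ((x i).val : ℤ) * ((x j).val : ℤ))}
      = p ^ ((n - 1) * (m - 1)) *
        Nat.card {x : Fin n → ZMod p //
          (¬ ∀ i, (p : ℤ) ∣ ((x i).val : ℤ)) ∧
          ((p : ℤ) ∣ ∑ i, ∑ j, A i j * ((x i).val : ℤ) * ((x j).val : ℤ))} := by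
  obtain ⟨k, rfl⟩ := Nat.exists_eq_add_of_le' hm
  have h := hA.primitiveZeroCount_pow_succ hp hodd hdet k
  simpa only [primitiveZeroCount, Nat.cast_pow, Fintype.card_fin, Nat.add_sub_cancel] using h
end

section
/- Let n ≥ 3 be an integer and ε > 0. For any non-singular quadratic form Q(x₁,...,xₙ) = Σ_{i,j=1}^{n} b_{ij} xᵢ xⱼ with integer coefficients, the number of integer points (x₁,...,xₙ) ∈ ℤ^n with Q(x₁,...,xₙ) = 0 and |xᵢ| ≤ N for all i is O(N^{n−2+ε}) as N → ∞, where the implied constant depends only on Q and ε. -/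
section

open Finset

/-- The divisor bound `d(n) = O(n ^ ε)`. -/
theorem exists_card_divisors_le_rpow {ε : ℝ} (hε : 0 < ε) :
    ∃ C : ℝ, 0 < C ∧ ∀ n : ℕ, n ≠ 0 → (#n.divisors : ℝ) ≤ C * (n : ℝ) ^ ε := by
  have hlog : 0 < Real.log 2 := Real.log_pos one_lt_two
  set A : ℝ := 1 + 1 / (ε * Real.log 2) with hA
  have hA1 : 1 ≤ A := by rw [hA]; simp only [le_add_iff_nonneg_right]; positivity
  have hA0 : 0 ≤ A := by linarith
  set K : ℕ := ⌈(2 : ℝ) ^ (1 / ε)⌉₊ with hK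
  have hfactor : ∀ p k : ℕ, p.Prime →
      ((k : ℝ) + 1) ≤ (if p < K then A else 1) * ((p : ℝ) ^ k) ^ ε := by
    intro p k hp
    have hp2 : (2 : ℝ) ≤ p := by exact_mod_cast hp.two_le
    rw [← Real.rpow_natCast_mul (by positivity)]
    split_ifs with h
    · have h1 : (k : ℝ) * ε * Real.log 2 + 1 ≤ (p : ℝ) ^ ((k : ℝ) * ε) := by
        calc (k : ℝ) * ε * Real.log 2 + 1 ≤ Real.exp (k * ε * Real.log 2) :=
              Real.add_one_le_exp _
          _ = (2 : ℝ) ^ ((k : ℝ) * ε) := by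
              rw [Real.rpow_def_of_pos two_pos, mul_comm]
          _ ≤ _ := Real.rpow_le_rpow two_pos.le hp2 (by positivity)
      have h2 : (k : ℝ) + 1 ≤ A * ((k : ℝ) * ε * Real.log 2 + 1) := by
        have : A * ((k : ℝ) * ε * Real.log 2 + 1)
            = k + 1 + (k : ℝ) * ε * Real.log 2 + 1 / (ε * Real.log 2) := by
          rw [hA]; field_simp; ring
        rw [this]
        have : 0 ≤ (k : ℝ) * ε * Real.log 2 + 1 / (ε * Real.log 2) := by positivity
        linarith
      exact h2.trans (mul_le_mul_of_nonneg_left h1 hA0)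
    · have hpK : (2 : ℝ) ^ (1 / ε) ≤ p :=
        (Nat.le_ceil _).trans (by exact_mod_cast not_lt.mp h)
      have hpε : (2 : ℝ) ≤ (p : ℝ) ^ ε := by
        have := Real.rpow_le_rpow (by positivity) hpK hε.le
        rwa [← Real.rpow_mul two_pos.le, one_div_mul_cancel hε.ne', Real.rpow_one] at this
      rw [one_mul, mul_comm, Real.rpow_mul_natCast (by positivity)]
      calc (k : ℝ) + 1 ≤ 2 ^ k := by exact_mod_cast Nat.lt_two_pow_self
        _ ≤ _ := pow_le_pow_left₀ two_pos.le hpε k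
  refine ⟨A ^ K, by positivity, fun n hn ↦ ?_⟩
  have hn' : (n : ℝ) ^ ε = ∏ p ∈ n.primeFactors, ((p : ℝ) ^ n.factorization p) ^ ε := by
    rw [Real.finsetProd_rpow _ _ (fun p _ ↦ by positivity)]
    congr 1
    conv_lhs => rw [← Nat.prod_factorization_pow_eq_self hn]
    simp [Finsupp.prod]
  rw [Nat.card_divisors hn, hn']
  push_cast
  calc ∏ p ∈ n.primeFactors, ((n.factorization p : ℝ) + 1)
      ≤ ∏ p ∈ n.primeFactors, (if p < K then A else 1) * ((p : ℝ) ^ n.factorization p) ^ ε :=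
        prod_le_prod (fun _ _ ↦ by positivity)
          fun p hp ↦ hfactor p _ (Nat.prime_of_mem_primeFactors hp)
    _ = A ^ #{p ∈ n.primeFactors | p < K}
          * ∏ p ∈ n.primeFactors, ((p : ℝ) ^ n.factorization p) ^ ε := by
        rw [prod_mul_distrib, ← prod_filter, prod_const]
    _ ≤ _ := by
        gcongr
        calc #{p ∈ n.primeFactors | p < K} ≤ #(range K) :=
              card_le_card fun p hp ↦ by simpa using (mem_filter.mp hp).2
          _ = K := card_range K

theorem card_filter_mul_mul_eq_le {a k : ℤ} (hk : k ≠ 0) (S : Finset (ℤ × ℤ)) :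
    #{p ∈ S | a * p.1 * p.2 = k} ≤ 2 * #k.natAbs.divisors := by
  have hsub : Set.InjOn Prod.fst (↑{p ∈ S | a * p.1 * p.2 = k} : Set (ℤ × ℤ)) := by
    rintro ⟨u, v⟩ h ⟨u', v'⟩ h' (rfl : u = u')
    simp only [coe_filter, Set.mem_ofPred_eq] at h h'
    have hu : a * u ≠ 0 := fun h0 ↦ hk (by rw [← h.2, h0, zero_mul])
    simpa using mul_left_cancel₀ hu (h.2.trans h'.2.symm)
  rw [← card_image_of_injOn hsub]
  calc _ ≤ #(k.natAbs.divisors.image (fun d : ℕ ↦ (d : ℤ)) ∪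
        k.natAbs.divisors.image (fun d : ℕ ↦ -(d : ℤ))) := by
        refine card_le_card fun u hu ↦ ?_
        obtain ⟨⟨u', v⟩, h, rfl⟩ := mem_image.mp hu
        have hd : u'.natAbs ∈ k.natAbs.divisors := by
          rw [Nat.mem_divisors]
          exact ⟨Int.natAbs_dvd_natAbs.mpr ⟨a * v, by rw [← (mem_filter.mp h).2]; ring⟩,
            Int.natAbs_ne_zero.mpr hk⟩
        rw [mem_union, mem_image, mem_image]
        rcases Int.natAbs_eq u' with h' | h'
        · exact Or.inl ⟨_, hd, h'.symm⟩
        · exact Or.inr ⟨_, hd, h'.symm⟩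
    _ ≤ _ := (card_union_le _ _).trans (by
        rw [two_mul]; exact add_le_add card_image_le card_image_le)

theorem card_filter_mul_mul_eq_zero_le {a : ℤ} (ha : a ≠ 0) (S : Finset ℤ) :
    #{p ∈ S ×ˢ S | a * p.1 * p.2 = 0} ≤ 2 * #S := by
  calc _ ≤ #(({0} : Finset ℤ) ×ˢ S ∪ S ×ˢ {0}) := by
        refine card_le_card fun p hp ↦ ?_
        simp only [mem_filter, mem_product, mul_eq_zero, ha, false_or] at hp
        simp only [mem_union, mem_product, mem_singleton]
        tauto
    _ ≤ _ := (card_union_le _ _).trans (by simp [two_mul])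

/-- The zeros of a nonzero quadratic form have codimension at least one in a box. -/
theorem card_filter_quadratic_eq_zero_le {m : ℕ} (c : Matrix (Fin m) (Fin m) ℤ)
    (hc : ∃ z : Fin m → ℤ, ∑ i, ∑ j, c i j * z i * z j ≠ 0) :
    ∃ d : ℕ, ∀ S : Finset ℤ,
      #{z ∈ Fintype.piFinset fun _ : Fin m ↦ S | ∑ i, ∑ j, c i j * z i * z j = 0} * #S
        ≤ d * #S ^ m := by
  let P : MvPolynomial (Fin m) ℤ :=
    ∑ i, ∑ j, MvPolynomial.C (c i j) * MvPolynomial.X i * MvPolynomial.X j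
  have heval : ∀ z : Fin m → ℤ, MvPolynomial.eval z P = ∑ i, ∑ j, c i j * z i * z j := by
    intro z; simp [P]
  have hP : P ≠ 0 := by
    rintro h
    obtain ⟨z, hz⟩ := hc
    exact hz (by rw [← heval, h, map_zero])
  refine ⟨P.totalDegree, fun S ↦ ?_⟩
  rcases S.eq_empty_or_nonempty with rfl | hS
  · simp
  have h := MvPolynomial.schwartz_zippel_totalDegree hP S
  simp only [heval] at h
  have hS0 : (0 : ℚ≥0) < #S := by exact_mod_cast hS.card_pos
  rw [div_le_div_iff₀ (by positivity) hS0] at h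
  exact_mod_cast h

theorem card_hyperbolic_le {m : ℕ} {ε : ℝ} (hε : 0 < ε) {a : ℤ} (ha : a ≠ 0)
    (c : Matrix (Fin m) (Fin m) ℤ)
    (hc : ∃ z : Fin m → ℤ, ∑ i, ∑ j, c i j * z i * z j ≠ 0) :
    ∃ C : ℝ, ∀ M : ℕ, 1 ≤ M →
      (#{p ∈ (Fintype.piFinset fun _ : Fin m ↦ Icc (-(M : ℤ)) M) ×ˢ
            (Icc (-(M : ℤ)) M ×ˢ Icc (-(M : ℤ)) M) |
          a * p.2.1 * p.2.2 = ∑ i, ∑ j, c i j * p.1 i * p.1 j} : ℝ)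
        ≤ C * (M : ℝ) ^ ((m : ℝ) + ε) := by
  obtain ⟨C₁, hC₁, hdiv⟩ := exists_card_divisors_le_rpow (half_pos hε)
  obtain ⟨d, hd⟩ := card_filter_quadratic_eq_zero_le c hc
  set H : ℕ := ∑ i, ∑ j, (c i j).natAbs with hH
  refine ⟨3 ^ m * (2 * C₁ * (H : ℝ) ^ (ε / 2)) + 2 * d * 3 ^ m, fun M hM ↦ ?_⟩
  set S : Finset ℤ := Icc (-(M : ℤ)) M with hS
  have hScard : #S ≤ 3 * M := by rw [hS, Int.card_Icc]; omega
  set Z := Fintype.piFinset fun _ : Fin m ↦ S with hZ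
  have hZcard : #Z = #S ^ m := by simp [hZ]
  let q : (Fin m → ℤ) → ℤ := fun z ↦ ∑ i, ∑ j, c i j * z i * z j
  have hM0 : (1 : ℝ) ≤ M := by exact_mod_cast hM
  have hsize : ∀ z ∈ Z, (q z).natAbs ≤ H * M ^ 2 := by
    intro z hz
    have hzi : ∀ i, (z i).natAbs ≤ M := fun i ↦ by
      have := mem_Icc.mp (Fintype.mem_piFinset.mp hz i); omega
    calc (q z).natAbs ≤ ∑ i, (∑ j, c i j * z i * z j).natAbs := Int.natAbs_sum_le _ _
      _ ≤ ∑ i, ∑ j, (c i j * z i * z j).natAbs :=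
          sum_le_sum fun i _ ↦ Int.natAbs_sum_le _ _
      _ ≤ ∑ i, ∑ j, (c i j).natAbs * M ^ 2 := by
          refine sum_le_sum fun i _ ↦ sum_le_sum fun j _ ↦ ?_
          rw [Int.natAbs_mul, Int.natAbs_mul, mul_assoc, sq]
          exact Nat.mul_le_mul_left _ (Nat.mul_le_mul (hzi i) (hzi j))
      _ = _ := by simp only [hH, sum_mul]
  have hfibre : ∀ z ∈ Z, q z ≠ 0 → (#{p ∈ S ×ˢ S | a * p.1 * p.2 = q z} : ℝ)
      ≤ 2 * C₁ * (H : ℝ) ^ (ε / 2) * (M : ℝ) ^ ε := by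
    intro z hz hq
    have h2 : ((#{p ∈ S ×ˢ S | a * p.1 * p.2 = q z} : ℕ) : ℝ)
        ≤ 2 * (#(q z).natAbs.divisors : ℝ) := by
      exact_mod_cast card_filter_mul_mul_eq_le hq (S ×ˢ S)
    have h3 : (((q z).natAbs : ℕ) : ℝ) ≤ (H : ℝ) * (M : ℝ) ^ 2 := by
      exact_mod_cast hsize z hz
    calc _ ≤ 2 * (#(q z).natAbs.divisors : ℝ) := h2
      _ ≤ 2 * (C₁ * ((q z).natAbs : ℝ) ^ (ε / 2)) := by
          gcongr; exact hdiv _ (Int.natAbs_ne_zero.mpr hq)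
      _ ≤ 2 * (C₁ * ((H : ℝ) * (M : ℝ) ^ 2) ^ (ε / 2)) := by gcongr
      _ = _ := by
          rw [Real.mul_rpow (by positivity) (by positivity),
            ← Real.rpow_natCast_mul (by positivity)]
          push_cast
          rw [mul_div_cancel₀ ε two_ne_zero]; ring
  have hcount : #{p ∈ Z ×ˢ (S ×ˢ S) | a * p.2.1 * p.2.2 = q p.1}
      = ∑ z ∈ Z, #{p ∈ S ×ˢ S | a * p.1 * p.2 = q z} := by
    simp only [card_filter, sum_product]
  change (#{p ∈ Z ×ˢ (S ×ˢ S) | a * p.2.1 * p.2.2 = q p.1} : ℝ) ≤ _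
  rw [hcount, ← sum_filter_add_sum_filter_not Z (fun z ↦ q z = 0)]
  have hzero : ∑ z ∈ Z with q z = 0, #{p ∈ S ×ˢ S | a * p.1 * p.2 = q z}
      ≤ 2 * d * (3 * M) ^ m := by
    calc _ ≤ ∑ z ∈ Z with q z = 0, 2 * #S := by
          refine sum_le_sum fun z hz ↦ ?_
          rw [(mem_filter.mp hz).2]
          exact card_filter_mul_mul_eq_zero_le ha S
      _ = 2 * (#{z ∈ Z | q z = 0} * #S) := by rw [sum_const, smul_eq_mul]; ring
      _ ≤ 2 * (d * #S ^ m) := Nat.mul_le_mul_left _ (hd S)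
      _ ≤ 2 * (d * (3 * M) ^ m) := by gcongr
      _ = _ := by ring
  have hnonzero : (∑ z ∈ Z with ¬ q z = 0, (#{p ∈ S ×ˢ S | a * p.1 * p.2 = q z} : ℝ))
      ≤ (3 * M) ^ m * (2 * C₁ * (H : ℝ) ^ (ε / 2) * (M : ℝ) ^ ε) := by
    calc _ ≤ ∑ z ∈ Z with ¬ q z = 0, 2 * C₁ * (H : ℝ) ^ (ε / 2) * (M : ℝ) ^ ε :=
          sum_le_sum fun z hz ↦ hfibre z (mem_filter.mp hz).1 (mem_filter.mp hz).2
      _ = (#{z ∈ Z | ¬ q z = 0} : ℝ) * (2 * C₁ * (H : ℝ) ^ (ε / 2) * (M : ℝ) ^ ε) := by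
          rw [sum_const, nsmul_eq_mul]
      _ ≤ _ := by
          gcongr
          have : #{z ∈ Z | ¬ q z = 0} ≤ (3 * M) ^ m :=
            (card_filter_le _ _).trans (hZcard ▸ Nat.pow_le_pow_left hScard m)
          exact_mod_cast this
  have hMε : (1 : ℝ) ≤ (M : ℝ) ^ ε := Real.one_le_rpow hM0 hε.le
  rw [Real.rpow_add (by positivity), Real.rpow_natCast]
  push_cast
  calc _ ≤ (2 * d * (3 * M) ^ m : ℝ) * (M : ℝ) ^ ε
        + (3 * M) ^ m * (2 * C₁ * (H : ℝ) ^ (ε / 2) * (M : ℝ) ^ ε) := by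
        refine add_le_add (le_trans ?_ (le_mul_of_one_le_right (by positivity) hMε)) hnonzero
        exact_mod_cast hzero
    _ = _ := by rw [mul_pow]; ring

/-- A nondegenerate symmetric bilinear form with an isotropic vector splits off a hyperbolic
plane. -/
theorem exists_hyperbolic_coordinates {K V : Type*} [Field K] [NeZero (2 : K)]
    [AddCommGroup V] [Module K V] [FiniteDimensional K V] {m : ℕ} (hm : 0 < m)
    (hV : Module.finrank K V = m + 2) (β : LinearMap.BilinForm K V)
    (hsymm : ∀ x y, β x y = β y x) (hnondeg : ∀ x, (∀ y, β x y = 0) → x = 0)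
    {e : V} (he : e ≠ 0) (hee : β e e = 0) :
    ∃ (u v : V →ₗ[K] K) (z : V →ₗ[K] (Fin m → K)) (a : K) (c : Matrix (Fin m) (Fin m) K),
      a ≠ 0 ∧ (∃ y : Fin m → K, ∑ i, ∑ j, c i j * y i * y j ≠ 0) ∧
      (∀ x, u x = 0 → v x = 0 → z x = 0 → x = 0) ∧
      ∀ x, β x x = a * u x * v x + ∑ i, ∑ j, c i j * z x i * z x j := by
  have h2 : (2 : K) ≠ 0 := two_ne_zero
  obtain ⟨g, hg⟩ : ∃ g, β e g ≠ 0 := by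
    by_contra! h
    exact he (hnondeg e h)
  obtain ⟨f, hff, hef⟩ : ∃ f, β f f = 0 ∧ β e f ≠ 0 := by
    refine ⟨(2 * β e g) • g - β g g • e, ?_, ?_⟩
    · simp only [map_sub, map_smul, LinearMap.sub_apply, LinearMap.smul_apply, smul_eq_mul, hee,
        hsymm g e]
      ring
    · simp only [map_sub, map_smul, smul_eq_mul, hee, mul_zero, sub_zero]
      exact mul_ne_zero (mul_ne_zero h2 hg) hg
  set b := β e f with hb
  have hfe : β f e = b := hsymm f e
  let u : V →ₗ[K] K := β f
  let v : V →ₗ[K] K := β e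
  let ℓ : V →ₗ[K] K × K := u.prod v
  have hsurj : Function.Surjective ℓ := by
    rintro ⟨s, t⟩
    refine ⟨(s / b) • e + (t / b) • f, ?_⟩
    simp [ℓ, u, v, hee, hff, hfe, ← hb, hef]
  have hrank : Module.finrank K (LinearMap.ker ℓ) = m := by
    have h := ℓ.finrank_range_add_finrank_ker
    rw [LinearMap.range_eq_top.mpr hsurj, finrank_top, hV] at h
    simp at h
    omega
  let w := Module.finBasisOfFinrankEq K (LinearMap.ker ℓ) hrank
  let π₀ : V →ₗ[K] V := LinearMap.id - (b⁻¹ • u).smulRight e - (b⁻¹ • v).smulRight f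
  have hπ₀ : ∀ x, π₀ x = x - (b⁻¹ * u x) • e - (b⁻¹ * v x) • f := fun x ↦ by simp [π₀]
  have hker : ∀ x, π₀ x ∈ LinearMap.ker ℓ := by
    intro x
    rw [LinearMap.mem_ker, hπ₀]
    simp [ℓ, u, v, hee, hff, hfe, ← hb, mul_right_comm, hef]
  have hmem : ∀ y ∈ LinearMap.ker ℓ, β f y = 0 ∧ β e y = 0 := fun y hy ↦ by
    simpa [ℓ, u, v] using hy
  let π : V →ₗ[K] LinearMap.ker ℓ := π₀.codRestrict _ hker
  have hπ : ∀ x, x = (π x : V) + (b⁻¹ * u x) • e + (b⁻¹ * v x) • f := by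
    intro x
    change x = π₀ x + _ + _
    rw [hπ₀]; abel
  let c : Matrix (Fin m) (Fin m) K := fun i j ↦ β (w i) (w j)
  have hform : ∀ y : LinearMap.ker ℓ,
      β y y = ∑ i, ∑ j, c i j * w.equivFun y i * w.equivFun y j := by
    intro y
    conv_lhs => rw [← w.sum_equivFun y]
    simp only [Submodule.coe_sum, Submodule.coe_smul, map_sum, map_smul, LinearMap.sum_apply,
      LinearMap.smul_apply, smul_eq_mul, c, mul_sum]
    rw [sum_comm]
    exact sum_congr rfl fun i _ ↦ sum_congr rfl fun j _ ↦ by ring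
  refine ⟨u, v, w.equivFun.toLinearMap ∘ₗ π, 2 * b⁻¹, c, mul_ne_zero h2 (inv_ne_zero hef),
    ?_, ?_, ?_⟩
  · by_contra! h
    have hzero : ∀ y ∈ LinearMap.ker ℓ, β y y = 0 := fun y hy ↦
      (hform ⟨y, hy⟩).trans (h _)
    have hw : ((w ⟨0, hm⟩ : LinearMap.ker ℓ) : V) = 0 := by
      refine hnondeg _ fun x ↦ ?_
      set y := w ⟨0, hm⟩
      have h1 := hzero _ (y + π x).2
      have h3 := hzero _ y.2
      have h4 := hzero _ (π x).2
      have h5 := hmem _ y.2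
      simp only [Submodule.coe_add, map_add, LinearMap.add_apply, h3, h4, hsymm (π x) y] at h1
      have h6 : β y (π x) = 0 := by
        have : 2 * β y (π x) = 0 := by linear_combination h1
        exact (mul_eq_zero.mp this).resolve_left h2
      conv_lhs => rw [hπ x]
      simp [h6, hsymm y e, hsymm y f, h5]
    exact w.ne_zero ⟨0, hm⟩ (Subtype.ext hw)
  · intro x hu hv hz
    have : π x = 0 := w.equivFun.map_eq_zero_iff.mp hz
    rw [hπ x, this, hu, hv]; simp
  · intro x
    have h5 := hmem _ (π x).2
    change β x x = _ + ∑ i, ∑ j, c i j * w.equivFun (π x) i * w.equivFun (π x) j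
    rw [← hform]
    conv_lhs => rw [hπ x]
    simp only [map_add, map_smul, LinearMap.add_apply, LinearMap.smul_apply, smul_eq_mul, h5.1,
      h5.2, hsymm (π x) e, hsymm (π x) f, hee, hff, hfe, ← hb]
    field_simp
    ring

/-- Finitely many rational numbers have a common denominator. -/
theorem exists_int_mul_eq {ι : Type*} [Finite ι] (g : ι → ℚ) :
    ∃ D : ℤ, D ≠ 0 ∧ ∃ k : ι → ℤ, ∀ i, (k i : ℚ) = D * g i := by
  obtain ⟨D, hD⟩ := IsLocalization.exist_integer_multiples_of_finite (nonZeroDivisors ℤ) g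
  choose k hk using hD
  exact ⟨D, nonZeroDivisors.coe_ne_zero D, k, fun i ↦ by simpa using hk i⟩

theorem exists_int_matrix_mulVec_eq {ι κ : Type*} [Finite ι] [Fintype κ] [DecidableEq κ]
    (φ : (κ → ℚ) →ₗ[ℚ] (ι → ℚ)) :
    ∃ D : ℤ, D ≠ 0 ∧ ∃ A : Matrix ι κ ℤ, ∀ (x : κ → ℤ) (i : ι),
      ((A.mulVec x i : ℤ) : ℚ) = D * φ (fun j ↦ (x j : ℚ)) i := by
  obtain ⟨D, hD, k, hk⟩ := exists_int_mul_eq fun p : ι × κ ↦ LinearMap.toMatrix' φ p.1 p.2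
  refine ⟨D, hD, fun i j ↦ k (i, j), fun x i ↦ ?_⟩
  rw [← LinearMap.toMatrix'_mulVec φ]
  simp [Matrix.mulVec, dotProduct, hk, mul_sum, mul_assoc]

theorem exists_abs_mulVec_le {ι κ : Type*} [Fintype ι] [Fintype κ] (A : Matrix ι κ ℤ) :
    ∃ L : ℕ, ∀ (N : ℕ) (x : κ → ℤ), (∀ j, |x j| ≤ N) → ∀ i, |A.mulVec x i| ≤ (L * N : ℕ) := by
  refine ⟨∑ i, ∑ j, (A i j).natAbs, fun N x hx i ↦ ?_⟩
  push_cast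
  calc |A.mulVec x i| ≤ ∑ j, |A i j * x j| := abs_sum_le_sum_abs _ _
    _ ≤ ∑ j, |A i j| * N := sum_le_sum fun j _ ↦ by
        rw [abs_mul]; exact mul_le_mul_of_nonneg_left (hx j) (abs_nonneg _)
    _ = (∑ j, |A i j|) * N := by rw [sum_mul]
    _ ≤ (∑ i, ∑ j, |A i j|) * N := by
        gcongr
        exact single_le_sum (f := fun i ↦ ∑ j, |A i j|)
          (fun i _ ↦ sum_nonneg fun j _ ↦ abs_nonneg _) (mem_univ i)

/-- Solutions of an isotropic quadratic equation embed linearly into those of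
`a * u * v = q z` with `q` a nonzero form in two variables fewer. -/
theorem exists_int_hyperbolic_coordinates {m : ℕ} (hm : 0 < m)
    (B : Matrix (Fin (m + 2)) (Fin (m + 2)) ℤ) (hB : B.IsSymm) (hdet : B.det ≠ 0)
    {e : Fin (m + 2) → ℤ} (he : e ≠ 0) (hee : ∑ i, ∑ j, B i j * e i * e j = 0) :
    ∃ (a : ℤ) (c : Matrix (Fin m) (Fin m) ℤ) (L : ℕ)
      (F : (Fin (m + 2) → ℤ) → (Fin m → ℤ) × ℤ × ℤ),
      a ≠ 0 ∧ (∃ y : Fin m → ℤ, ∑ i, ∑ j, c i j * y i * y j ≠ 0) ∧ 1 ≤ L ∧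
      Function.Injective F ∧
      (∀ (N : ℕ) (x : Fin (m + 2) → ℤ), (∀ j, |x j| ≤ N) →
        (∀ i, |(F x).1 i| ≤ (L * N : ℕ)) ∧ |(F x).2.1| ≤ (L * N : ℕ) ∧
          |(F x).2.2| ≤ (L * N : ℕ)) ∧
      ∀ x, ∑ i, ∑ j, B i j * x i * x j = 0 →
        a * (F x).2.1 * (F x).2.2 = ∑ i, ∑ j, c i j * (F x).1 i * (F x).1 j := by
  let Bq : Matrix (Fin (m + 2)) (Fin (m + 2)) ℚ := B.map (Int.castRingHom ℚ)
  have hBq : Bq.det ≠ 0 := by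
    change (((Int.castRingHom ℚ).mapMatrix B)).det ≠ 0
    rw [← RingHom.map_det]
    simpa using hdet
  let β : LinearMap.BilinForm ℚ (Fin (m + 2) → ℚ) := Matrix.toBilin' Bq
  have hβ : ∀ x y, β x y = ∑ i, ∑ j, x i * Bq i j * y j := Matrix.toBilin'_apply Bq
  have hβint : ∀ x : Fin (m + 2) → ℤ, β (fun i ↦ (x i : ℚ)) (fun i ↦ (x i : ℚ))
      = ((∑ i, ∑ j, B i j * x i * x j : ℤ) : ℚ) := by
    intro x
    rw [hβ]
    push_cast
    refine sum_congr rfl fun i _ ↦ sum_congr rfl fun j _ ↦ ?_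
    simp [Bq, mul_comm (x i : ℚ)]
  have hsymm : ∀ x y, β x y = β y x := by
    intro x y
    rw [hβ, hβ, sum_comm]
    refine sum_congr rfl fun i _ ↦ sum_congr rfl fun j _ ↦ ?_
    simp only [Bq, Matrix.map_apply, hB.apply i j]
    ring
  have hnondeg : ∀ x, (∀ y, β x y = 0) → x = 0 := by
    intro x hx
    refine Matrix.eq_zero_of_vecMul_eq_zero hBq ?_
    ext j
    have := hx (Pi.single j 1)
    rw [hβ] at this
    simpa [Matrix.vecMul, dotProduct, Pi.single_apply] using this
  have he' : (fun i ↦ (e i : ℚ)) ≠ 0 := fun h ↦ he (funext fun i ↦ by simpa using congrFun h i)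
  obtain ⟨u, v, z, a, c, ha, ⟨y, hy⟩, hinj, hform⟩ := exists_hyperbolic_coordinates hm
    (by simp) β hsymm hnondeg he' (by rw [hβint, hee, Int.cast_zero])
  obtain ⟨D₁, hD₁, A₁, hA₁⟩ := exists_int_matrix_mulVec_eq (LinearMap.pi fun _ : Unit ↦ u)
  obtain ⟨D₂, hD₂, A₂, hA₂⟩ := exists_int_matrix_mulVec_eq (LinearMap.pi fun _ : Unit ↦ v)
  obtain ⟨D₃, hD₃, A₃, hA₃⟩ := exists_int_matrix_mulVec_eq z
  obtain ⟨E₁, hE₁, a', ha'⟩ := exists_int_mul_eq fun _ : Unit ↦ a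
  obtain ⟨E₂, hE₂, c', hc'⟩ := exists_int_mul_eq fun p : Fin m × Fin m ↦ c p.1 p.2
  obtain ⟨E₃, hE₃, y', hy'⟩ := exists_int_mul_eq y
  obtain ⟨L₁, hL₁⟩ := exists_abs_mulVec_le A₁
  obtain ⟨L₂, hL₂⟩ := exists_abs_mulVec_le A₂
  obtain ⟨L₃, hL₃⟩ := exists_abs_mulVec_le A₃
  simp only [LinearMap.pi_apply] at hA₁ hA₂
  refine ⟨a' () * E₂ * D₃ ^ 2, fun i j ↦ -(E₁ * D₁ * D₂) * c' (i, j), L₁ + L₂ + L₃ + 1,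
    fun x ↦ (A₃.mulVec x, A₁.mulVec x (), A₂.mulVec x ()), ?_, ⟨y', ?_⟩, by omega, ?_, ?_, ?_⟩
  · have : a' () ≠ 0 := by
      rw [← Int.cast_ne_zero (α := ℚ), ha']
      exact mul_ne_zero (by exact_mod_cast hE₁) ha
    positivity
  · rw [← Int.cast_ne_zero (α := ℚ)]
    have : ((∑ i, ∑ j, -(E₁ * D₁ * D₂) * c' (i, j) * y' i * y' j : ℤ) : ℚ)
        = -(E₁ * D₁ * D₂ * E₂ * E₃ ^ 2) * ∑ i, ∑ j, c i j * y i * y j := by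
      push_cast
      simp only [hc', hy', mul_sum]
      exact sum_congr rfl fun i _ ↦ sum_congr rfl fun j _ ↦ by ring
    rw [this]
    refine mul_ne_zero (neg_ne_zero.mpr ?_) hy
    exact_mod_cast (by positivity : E₁ * D₁ * D₂ * E₂ * E₃ ^ 2 ≠ 0)
  · intro x x' hxx
    simp only [Prod.mk.injEq] at hxx
    obtain ⟨h₃, h₁, h₂⟩ := hxx
    have hsub : (fun i ↦ ((x i : ℤ) : ℚ)) - (fun i ↦ ((x' i : ℤ) : ℚ)) = 0 := by
      apply hinj
      · rw [map_sub, sub_eq_zero]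
        refine mul_left_cancel₀ (Int.cast_ne_zero.mpr hD₁ : (D₁ : ℚ) ≠ 0) ?_
        rw [← hA₁ x (), ← hA₁ x' (), h₁]
      · rw [map_sub, sub_eq_zero]
        refine mul_left_cancel₀ (Int.cast_ne_zero.mpr hD₂ : (D₂ : ℚ) ≠ 0) ?_
        rw [← hA₂ x (), ← hA₂ x' (), h₂]
      · rw [map_sub, sub_eq_zero]
        ext i
        refine mul_left_cancel₀ (Int.cast_ne_zero.mpr hD₃ : (D₃ : ℚ) ≠ 0) ?_
        rw [← hA₃ x i, ← hA₃ x' i, h₃]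
    funext i
    exact Int.cast_injective (α := ℚ) (congrFun (sub_eq_zero.mp hsub) i)
  · intro N x hx
    have hmono : ∀ {t : ℤ} {l : ℕ}, |t| ≤ (l * N : ℕ) → l ≤ L₁ + L₂ + L₃ + 1 →
        |t| ≤ ((L₁ + L₂ + L₃ + 1) * N : ℕ) := fun ht hl ↦
      ht.trans (by exact_mod_cast Nat.mul_le_mul_right N hl)
    exact ⟨fun i ↦ hmono (hL₃ N x hx i) (by omega), hmono (hL₁ N x hx ()) (by omega),
      hmono (hL₂ N x hx ()) (by omega)⟩
  · intro x hx
    have h := hform fun i ↦ (x i : ℚ)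
    rw [hβint, hx, Int.cast_zero] at h
    rw [← Int.cast_inj (α := ℚ)]
    push_cast
    simp only [hA₁, hA₂, hA₃, ha', hc']
    have hsum : ∑ i, ∑ j, -((E₁ : ℚ) * D₁ * D₂) * (E₂ * c i j) * (D₃ * z (fun j ↦ (x j : ℚ)) i)
          * (D₃ * z (fun j ↦ (x j : ℚ)) j)
        = -(E₁ * D₁ * D₂ * E₂ * D₃ ^ 2)
          * ∑ i, ∑ j, c i j * z (fun j ↦ (x j : ℚ)) i * z (fun j ↦ (x j : ℚ)) j := by
      simp only [mul_sum]
      exact sum_congr rfl fun i _ ↦ sum_congr rfl fun j _ ↦ by ring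
    rw [hsum]
    linear_combination (-(E₁ * D₁ * D₂ * E₂ * D₃ ^ 2) : ℚ) * h

end


/-- Proposition 3 (Heath-Brown): for `n ≥ 3` and `ε > 0`, and any non-singular quadratic
form `Q(x) = Σ bᵢⱼxᵢxⱼ` with symmetric integer coefficient matrix `B` (`det B ≠ 0`),
the number of integer points `x` with `Q(x) = 0` and `|xᵢ| ≤ N` is `O(N^{n-2+ε})`,
with implied constant depending only on `Q` and `ε`. -/
theorem stmt7 (n : ℕ) (hn : 3 ≤ n) (ε : ℝ) (hε : 0 < ε)
    (B : Matrix (Fin n) (Fin n) ℤ) (hB : B.IsSymm) (hdet : B.det ≠ 0) :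
    ∃ C : ℝ, ∀ N : ℕ, 1 ≤ N →
      (Nat.card {x : Fin n → ℤ //
          (∑ i, ∑ j, B i j * x i * x j) = 0 ∧ ∀ i, |x i| ≤ (N : ℤ)} : ℝ)
        ≤ C * (N : ℝ) ^ ((n : ℝ) - 2 + ε) := by
  obtain ⟨m, rfl⟩ : ∃ m, n = m + 2 := ⟨n - 2, by omega⟩
  have hexp : ((m + 2 : ℕ) : ℝ) - 2 + ε = m + ε := by push_cast; ring
  rw [hexp]
  by_cases hiso : ∃ e : Fin (m + 2) → ℤ, e ≠ 0 ∧ ∑ i, ∑ j, B i j * e i * e j = 0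
  · obtain ⟨e, he, hee⟩ := hiso
    obtain ⟨a, c, L, F, ha, hc, hL, hinj, hbound, heq⟩ :=
      exists_int_hyperbolic_coordinates (by omega) B hB hdet he hee
    obtain ⟨C, hC⟩ := card_hyperbolic_le hε ha c hc
    refine ⟨C * (L : ℝ) ^ ((m : ℝ) + ε), fun N hN ↦ ?_⟩
    have hcard := hC (L * N) (Nat.mul_pos hL hN)
    rw [Nat.cast_mul (α := ℝ), Real.mul_rpow (by positivity) (by positivity), ← mul_assoc] at hcard
    refine le_trans ?_ hcard
    rw [Nat.cast_le, ← Nat.card_eq_finsetCard]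
    refine Nat.card_le_card_of_injective (fun x ↦ ⟨F x.1, ?_⟩) fun x x' h ↦
      Subtype.ext (hinj (congrArg Subtype.val h))
    obtain ⟨h₁, h₂, h₃⟩ := hbound N x.1 x.2.2
    simp only [Finset.mem_filter, Finset.mem_product, Fintype.mem_piFinset, Finset.mem_Icc,
      ← abs_le]
    exact ⟨⟨h₁, h₂, h₃⟩, heq x.1 x.2.1⟩
  · push Not at hiso
    refine ⟨1, fun N hN ↦ ?_⟩
    have : Subsingleton {x : Fin (m + 2) → ℤ //
        (∑ i, ∑ j, B i j * x i * x j) = 0 ∧ ∀ i, |x i| ≤ (N : ℤ)} := by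
      have hzero : ∀ x : Fin (m + 2) → ℤ, ∑ i, ∑ j, B i j * x i * x j = 0 → x = 0 :=
        fun x hx ↦ by_contra fun h ↦ hiso x h hx
      exact ⟨fun x y ↦ Subtype.ext ((hzero x.1 x.2.1).trans (hzero y.1 y.2.1).symm)⟩
    rw [one_mul]
    calc (Nat.card _ : ℝ) ≤ 1 := by exact_mod_cast Finite.card_le_one_iff_subsingleton.mpr this
      _ ≤ _ := Real.one_le_rpow (by exact_mod_cast hN) (by positivity)
end

section
/- Let p be an odd prime and let l, m, r be integers with l ≥ 3 and m − r ≥ 2. Then (m−r)·l/2 − Σ_{k=1}^{∞} ⌊log_{p^k} l⌋ − (m−r) ≥ 0, where the sum runs over those k ≥ 1 with p^k ≤ l (i.e. the terms with ⌊log_{p^k} l⌋ ≥ 1). -/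
theorem sq_add_two_le_three_pow {n : ℕ} (hn : 1 ≤ n) : n ^ 2 + 2 ≤ 3 ^ n := by
  induction n, hn using Nat.le_induction with
  | base => norm_num
  | succ k hk ih =>
    rw [pow_succ 3 k]
    nlinarith

/-- Each of the `n = Nat.log b l` terms is at most `n`, and `n ^ 2 + 2 ≤ 3 ^ n ≤ b ^ n ≤ l`. -/
theorem sum_log_pow_add_two_le {b l : ℕ} (hb : 3 ≤ b) (hl : 2 ≤ l) :
    ∑ k ∈ Finset.Icc 1 (Nat.log b l), Nat.log (b ^ k) l + 2 ≤ l := by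
  have hsum : ∑ k ∈ Finset.Icc 1 (Nat.log b l), Nat.log (b ^ k) l ≤ Nat.log b l ^ 2 := by
    calc ∑ k ∈ Finset.Icc 1 (Nat.log b l), Nat.log (b ^ k) l
        ≤ ∑ _k ∈ Finset.Icc 1 (Nat.log b l), Nat.log b l := by
          refine Finset.sum_le_sum fun k hk => Nat.log_anti_left (by omega) ?_
          exact Nat.le_self_pow (by have := (Finset.mem_Icc.mp hk).1; omega) b
      _ = Nat.log b l ^ 2 := by simp [sq]
  rcases Nat.eq_zero_or_pos (Nat.log b l) with h | h
  · simpa [h] using hl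
  · have hpow : 3 ^ Nat.log b l ≤ b ^ Nat.log b l := Nat.pow_le_pow_left hb _
    have hle : b ^ Nat.log b l ≤ l := Nat.pow_log_le_self b (by omega)
    have := sq_add_two_le_three_pow h
    omega

/-- The inequality \eqref{vanish1}: for an odd prime `p` and integers `l ≥ 3`, `m`, `r`
with `m - r ≥ 2`, one has `(m-r)·l/2 - Σ_{k ≥ 1, p^k ≤ l} ⌊log_{p^k} l⌋ - (m-r) ≥ 0`.
Here `⌊log_{p^k} l⌋ = Nat.log (p^k) l`, and the sum runs over `1 ≤ k ≤ Nat.log p l`,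
i.e. over those `k ≥ 1` with `p^k ≤ l`. -/
theorem stmt8 (p : ℕ) (hp : p.Prime) (hodd : p ≠ 2)
    (l : ℕ) (hl : 3 ≤ l) (m r : ℤ) (hmr : 2 ≤ m - r) :
    0 ≤ ((m : ℝ) - (r : ℝ)) * (l : ℝ) / 2
        - (∑ k ∈ Finset.Icc 1 (Nat.log p l), (Nat.log (p ^ k) l : ℝ))
        - ((m : ℝ) - (r : ℝ)) := by
  have hp3 : 3 ≤ p := by have := hp.two_le; omega
  have hsum : (∑ k ∈ Finset.Icc 1 (Nat.log p l), (Nat.log (p ^ k) l : ℝ)) + 2 ≤ l := by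
    exact_mod_cast sum_log_pow_add_two_le hp3 (by omega : 2 ≤ l)
  have hl' : (3 : ℝ) ≤ l := by exact_mod_cast hl
  have hmr' : (2 : ℝ) ≤ (m : ℝ) - r := by exact_mod_cast hmr
  nlinarith
end
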